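/- arXiv:1008.3475 — 3 statements merged into one kernel-verified Lean document; each statement's English description precedes it below -/
import Mathlib

section
/- For all integers n ≥ 0 and α ≥ 0, p̄_o(3^{2α}(9n+6)) ≡ 0 (mod 3). -/
/-- Number of overpartitions of `n` into odd parts: pairs consisting of a
partition of some `m ≤ n` into distinct odd parts (the overlined parts)
and a partition of `n - m` into odd parts. -/
def pbarOdd (n : ℕ) : ℕ :=
  ∑ m ∈ Finset.range (n + 1),
    (Nat.Partition.oddDistincts m).card * (Nat.Partition.odds (n - m)).card

open PowerSeries

/-- Gaussian binomial coefficients evaluated at an element `Q` of a ring. -/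
def gaussBinom {R : Type*} [CommRing R] (Q : R) : ℕ → ℕ → R
  | _, 0 => 1
  | 0, _ + 1 => 0
  | n + 1, k + 1 => gaussBinom Q n k + Q ^ (k + 1) * gaussBinom Q n (k + 1)

section gaussBinom
variable {R : Type*} [CommRing R] (Q : R)

@[simp] theorem gaussBinom_zero_right (n : ℕ) : gaussBinom Q n 0 = 1 := by
  cases n <;> rfl

theorem gaussBinom_succ_succ (n k : ℕ) :
    gaussBinom Q (n + 1) (k + 1) = gaussBinom Q n k + Q ^ (k + 1) * gaussBinom Q n (k + 1) := rfl

theorem gaussBinom_eq_zero_of_lt {n k : ℕ} (h : n < k) : gaussBinom Q n k = 0 := by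
  induction n generalizing k with
  | zero => obtain ⟨k, rfl⟩ := Nat.exists_eq_succ_of_ne_zero h.ne'; rfl
  | succ n ih =>
    obtain ⟨k, rfl⟩ := Nat.exists_eq_succ_of_ne_zero (by omega : k ≠ 0)
    rw [Nat.succ_eq_add_one, gaussBinom_succ_succ, ih (by omega), ih (by omega)]
    simp

theorem gaussBinom_mul_one_sub_pow (m d : ℕ) :
    gaussBinom Q (m + d) m * (1 - Q ^ d) =
      gaussBinom Q (m + d) (m + 1) * (1 - Q ^ (m + 1)) := by
  induction h : m + d generalizing m d with
  | zero =>
    obtain ⟨rfl, rfl⟩ : m = 0 ∧ d = 0 := by omega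
    simp [gaussBinom]
  | succ N ih =>
    rcases d with _ | d
    · rw [gaussBinom_eq_zero_of_lt Q (by omega : N + 1 < m + 1)]
      simp
    rcases m with _ | m
    · obtain rfl : d = N := by omega
      have := ih 0 d (by omega)
      simp only [gaussBinom_zero_right, zero_add, gaussBinom_succ_succ] at this ⊢
      linear_combination Q * this
    · have h1 := ih m (d + 1) (by omega)
      have h2 := ih (m + 1) d (by omega)
      obtain rfl : N = m + 1 + d := by omega
      simp only [gaussBinom_succ_succ]
      linear_combination h1 + Q ^ (m + 2) * h2

/-- The `q`-binomial theorem. -/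
theorem prod_add_mul_pow_eq_sum_gaussBinom (y w : R) (N : ℕ) :
    ∏ j ∈ Finset.range N, (y + w * Q ^ j) =
      ∑ m ∈ Finset.range (N + 1), gaussBinom Q N m * Q ^ (m.choose 2) * w ^ m * y ^ (N - m) := by
  induction N generalizing w with
  | zero => simp
  | succ N ih =>
    have h : ∏ j ∈ Finset.range N, (y + w * Q ^ (j + 1)) =
        ∏ j ∈ Finset.range N, (y + (w * Q) * Q ^ j) :=
      Finset.prod_congr rfl fun j _ => by ring
    rw [Finset.prod_range_succ', h, ih, pow_zero, mul_one, mul_add, Finset.sum_range_succ' _ (N + 1),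
      Finset.sum_mul, Finset.sum_mul]
    have h1 : ∑ m ∈ Finset.range (N + 1),
        gaussBinom Q N m * Q ^ (m.choose 2) * (w * Q) ^ m * y ^ (N - m) * y =
        ∑ m ∈ Finset.range (N + 1), gaussBinom Q N (m + 1) * Q ^ ((m + 1).choose 2) *
          (w * Q) ^ (m + 1) * y ^ (N - m) + y ^ (N + 1) := by
      rw [Finset.sum_range_succ', Finset.sum_range_succ _ N,
        gaussBinom_eq_zero_of_lt Q (Nat.lt_succ_self N)]
      simp only [Nat.choose_zero_succ, gaussBinom_zero_right, zero_mul, pow_zero, add_zero,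
        Nat.sub_zero, one_mul, pow_succ y N]
      congr 1
      refine Finset.sum_congr rfl fun m hm => ?_
      rw [show N - m = N - (m + 1) + 1 by have := Finset.mem_range.mp hm; omega]
      ring
    rw [h1, add_right_comm, ← Finset.sum_add_distrib]
    congr 1
    · refine Finset.sum_congr rfl fun m _ => ?_
      rw [gaussBinom_succ_succ, Nat.add_sub_add_right,
        show (m + 1).choose 2 = m + m.choose 2 by simp [Nat.choose_succ_succ' m 1]]
      ring
    · simp

theorem pow_dvd_gaussBinom_sub {D a b N : ℕ} (hab : a ≤ b) (ha : D ≤ a) (hb : b + D ≤ N) :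
    Q ^ D ∣ gaussBinom Q N a - gaussBinom Q N b := by
  induction b, hab using Nat.le_induction with
  | base => simp
  | succ b hab ih =>
    have h := gaussBinom_mul_one_sub_pow Q b (N - b)
    rw [Nat.add_sub_of_le (by omega)] at h
    have h1 : gaussBinom Q N b - gaussBinom Q N (b + 1) =
        gaussBinom Q N b * Q ^ (N - b) - gaussBinom Q N (b + 1) * Q ^ (b + 1) := by
      linear_combination h
    have h2 : Q ^ D ∣ gaussBinom Q N b - gaussBinom Q N (b + 1) := by
      rw [h1]
      exact dvd_sub (Dvd.dvd.mul_left (pow_dvd_pow Q (by omega)) _)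
        (Dvd.dvd.mul_left (pow_dvd_pow Q (by omega)) _)
    simpa using dvd_add (ih (by omega)) h2

theorem prod_range_pow_odd (q : R) (n : ℕ) :
    ∏ j ∈ Finset.range n, q ^ (2 * j + 1) = q ^ (n ^ 2) := by
  induction n with
  | zero => simp
  | succ n ih => rw [Finset.prod_range_succ, ih]; ring

/-- A finite form of Jacobi's triple product identity. -/
theorem sq_prod_one_add_pow_odd [IsDomain R] {q : R} (hq : q ≠ 0) (n : ℕ) :
    (∏ j ∈ Finset.range n, (1 + q ^ (2 * j + 1))) ^ 2 =
      ∑ m ∈ Finset.range (2 * n + 1),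
        gaussBinom (q ^ 2) (2 * n) m * q ^ (((m : ℤ) - n).natAbs ^ 2) := by
  have h := prod_add_mul_pow_eq_sum_gaussBinom (q ^ 2) (q ^ (2 * n)) q (2 * n)
  have hL : ∏ j ∈ Finset.range (2 * n), (q ^ (2 * n) + q * (q ^ 2) ^ j) =
      q ^ (3 * n ^ 2) * (∏ j ∈ Finset.range n, (1 + q ^ (2 * j + 1))) ^ 2 := by
    rw [two_mul n, Finset.prod_range_add, ← two_mul]
    have h1 : ∏ j ∈ Finset.range n, (q ^ (2 * n) + q * (q ^ 2) ^ j) =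
        q ^ (n ^ 2) * ∏ j ∈ Finset.range n, (1 + q ^ (2 * j + 1)) := by
      rw [← Finset.prod_range_reflect (fun j => 1 + q ^ (2 * j + 1)), ← prod_range_pow_odd,
        ← Finset.prod_mul_distrib]
      refine Finset.prod_congr rfl fun j hj => ?_
      have := Finset.mem_range.mp hj
      rw [mul_add, mul_one, ← pow_add,
        show 2 * j + 1 + (2 * (n - 1 - j) + 1) = 2 * n by omega]
      ring
    have h2 : ∏ j ∈ Finset.range n, (q ^ (2 * n) + q * (q ^ 2) ^ (n + j)) =
        q ^ (2 * n ^ 2) * ∏ j ∈ Finset.range n, (1 + q ^ (2 * j + 1)) := by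
      rw [show q ^ (2 * n ^ 2) = ∏ j ∈ Finset.range n, q ^ (2 * n) by
        rw [Finset.prod_const, Finset.card_range]; ring, ← Finset.prod_mul_distrib]
      exact Finset.prod_congr rfl fun j _ => by ring
    rw [h1, h2]
    ring
  rw [hL] at h
  refine mul_left_cancel₀ (pow_ne_zero (3 * n ^ 2) hq) (h.trans ?_)
  rw [Finset.mul_sum]
  refine Finset.sum_congr rfl fun m hm => ?_
  have hm' : m ≤ 2 * n := Nat.lt_succ_iff.mp (Finset.mem_range.mp hm)
  have hc : 2 * m.choose 2 + m = m ^ 2 := by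
    rw [Nat.choose_two_right, Nat.mul_div_cancel' (Nat.even_mul_pred_self m).two_dvd]
    cases m <;> simp; ring
  have he : 2 * m.choose 2 + m + 2 * n * (2 * n - m) =
      3 * n ^ 2 + ((m : ℤ) - n).natAbs ^ 2 := by
    rw [hc]
    zify [hm']
    rw [sq_abs]
    ring
  calc _ = gaussBinom (q ^ 2) (2 * n) m * q ^ (2 * m.choose 2 + m + 2 * n * (2 * n - m)) := by
        ring
    _ = _ := by rw [he]; ring

end gaussBinom

/-- The sign `(-1) ^ k` of an integer `k`, in a ring. -/
def altSign (R : Type*) [CommRing R] (k : ℤ) : R := if Even k then 1 else -1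

theorem altSign_eq_neg_one_pow {R : Type*} [CommRing R] (k : ℤ) :
    altSign R k = (-1) ^ (k.natAbs ^ 2) := by
  unfold altSign
  split_ifs with h
  · exact (Even.neg_one_pow (by simpa [Nat.even_pow, Int.natAbs_even] using h)).symm
  · exact (Odd.neg_one_pow (by
      simpa [Nat.odd_pow_iff, Int.natAbs_odd] using h)).symm

/-- The weighted theta series `∑ w k * X ^ (d * k ^ 2)` over all integers `k`. -/
noncomputable def thetaSeries {R : Type*} [CommRing R] (w : ℤ → R) (d : ℕ) : R⟦X⟧ :=
  mk fun n => ∑ k ∈ Finset.Icc (-n : ℤ) n, if (d : ℤ) * k ^ 2 = n then w k else 0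

/-- The integral solutions of `a * x ^ 2 + b * y ^ 2 = n`, for positive `a` and `b`. -/
noncomputable def diagSolutions (a b n : ℕ) : Finset (ℤ × ℤ) :=
  (Finset.Icc (-n : ℤ) n ×ˢ Finset.Icc (-n : ℤ) n).filter
    fun p => (a : ℤ) * p.1 ^ 2 + b * p.2 ^ 2 = n

theorem abs_le_of_mul_sq_le {d : ℕ} (hd : 0 < d) {k n : ℤ} (h : d * k ^ 2 ≤ n) :
    -n ≤ k ∧ k ≤ n := by
  have h1 : (1 : ℤ) ≤ d := by exact_mod_cast hd
  have h2 : k ^ 2 ≤ n := by nlinarith [sq_nonneg k]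
  have h3 : k ≤ k ^ 2 := by nlinarith [Int.le_self_sq k]
  have h4 : -k ≤ k ^ 2 := by simpa using Int.le_self_sq (-k)
  omega

theorem mem_diagSolutions {a b n : ℕ} (ha : 0 < a) (hb : 0 < b) {p : ℤ × ℤ} :
    p ∈ diagSolutions a b n ↔ (a : ℤ) * p.1 ^ 2 + b * p.2 ^ 2 = n := by
  simp only [diagSolutions, Finset.mem_filter, Finset.mem_product, Finset.mem_Icc,
    and_iff_right_iff_imp]
  intro h
  have h1 : 0 ≤ (a : ℤ) * p.1 ^ 2 := by positivity
  have h2 : 0 ≤ (b : ℤ) * p.2 ^ 2 := by positivity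
  exact ⟨abs_le_of_mul_sq_le ha (by linarith), abs_le_of_mul_sq_le hb (by linarith)⟩

section theta
variable {R : Type*} [CommRing R]

theorem coeff_thetaSeries_of_le (w : ℤ → R) {d : ℕ} (hd : 0 < d) {n N : ℕ} (h : n ≤ N) :
    coeff n (thetaSeries w d) =
      ∑ k ∈ Finset.Icc (-N : ℤ) N, if (d : ℤ) * k ^ 2 = n then w k else 0 := by
  rw [thetaSeries, coeff_mk]
  refine Finset.sum_subset (Finset.Icc_subset_Icc (by omega) (by omega)) fun k _ hk => ?_
  rw [if_neg]
  exact fun h => hk (Finset.mem_Icc.mpr (abs_le_of_mul_sq_le hd h.le))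

theorem coeff_thetaSeries_mul (v w : ℤ → R) {a b : ℕ} (ha : 0 < a) (hb : 0 < b) (n : ℕ) :
    coeff n (thetaSeries v a * thetaSeries w b) =
      ∑ p ∈ diagSolutions a b n, v p.1 * w p.2 := by
  rw [coeff_mul, diagSolutions, Finset.sum_filter, Finset.sum_product]
  have h : ∀ p ∈ Finset.HasAntidiagonal.antidiagonal n,
      coeff p.1 (thetaSeries v a) * coeff p.2 (thetaSeries w b) =
      ∑ x ∈ Finset.Icc (-n : ℤ) n, ∑ y ∈ Finset.Icc (-n : ℤ) n,
        if (a : ℤ) * x ^ 2 = p.1 ∧ (b : ℤ) * y ^ 2 = p.2 then v x * w y else 0 := by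
    intro p hp
    rw [coeff_thetaSeries_of_le v ha (Finset.HasAntidiagonal.antidiagonal.fst_le hp),
      coeff_thetaSeries_of_le w hb (Finset.HasAntidiagonal.antidiagonal.snd_le hp), Finset.sum_mul_sum]
    refine Finset.sum_congr rfl fun x _ => Finset.sum_congr rfl fun y _ => ?_
    rw [ite_and]
    split_ifs <;> simp
  rw [Finset.sum_congr rfl h, Finset.sum_comm]
  refine Finset.sum_congr rfl fun x _ => ?_
  rw [Finset.sum_comm]
  refine Finset.sum_congr rfl fun y _ => ?_
  split_ifs with hxy
  · rw [Finset.sum_eq_single (a * x.natAbs ^ 2, b * y.natAbs ^ 2)]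
    · simp
    · rintro ⟨i, j⟩ _ hne
      refine if_neg fun ⟨h1, h2⟩ => hne ?_
      simp only [Prod.mk.injEq]
      zify
      simp [h1, h2]
    · intro hn
      refine absurd (Finset.HasAntidiagonal.mem_antidiagonal.mpr ?_) hn
      zify
      simpa using hxy
  · refine Finset.sum_eq_zero fun p hp => if_neg fun ⟨h1, h2⟩ => hxy ?_
    rw [h1, h2]
    exact_mod_cast Finset.HasAntidiagonal.mem_antidiagonal.mp hp

theorem constantCoeff_thetaSeries_altSign (d : ℕ) :
    constantCoeff (thetaSeries (altSign R) d) = 1 := by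
  rw [← coeff_zero_eq_constantCoeff_apply, thetaSeries, coeff_mk]
  simp [altSign]

/-- `φ(q) φ(-q) = φ(-q²) ^ 2`. -/
theorem thetaSeries_mul_thetaSeries_altSign :
    thetaSeries (fun _ => 1) 1 * thetaSeries (altSign R) 1 = thetaSeries (altSign R) 2 ^ 2 := by
  ext n
  rw [sq, coeff_thetaSeries_mul _ _ one_pos one_pos, coeff_thetaSeries_mul _ _ two_pos two_pos,
    ← Finset.sum_filter_add_sum_filter_not _ (fun p : ℤ × ℤ => Even (p.1 + p.2))]
  have hodd : ∑ p ∈ diagSolutions 1 1 n with ¬ Even (p.1 + p.2), 1 * altSign R p.2 = 0 := by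
    refine Finset.sum_involution (fun p _ => (p.2, p.1)) ?_ ?_ ?_ ?_
    · intro p hp
      have h := (Finset.mem_filter.mp hp).2
      rw [Int.even_add] at h
      simp only [altSign]
      split_ifs <;> first | (exfalso; tauto) | ring
    · intro p hp _ he
      have h2 : p.1 = p.2 := (congrArg Prod.snd he)
      exact (Finset.mem_filter.mp hp).2 (h2 ▸ ⟨_, rfl⟩)
    · intro p hp
      simp only [Finset.mem_filter, mem_diagSolutions one_pos one_pos] at hp ⊢
      exact ⟨by linarith, by rw [add_comm]; exact hp.2⟩
    · intro p _; rfl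
  rw [hodd, add_zero]
  symm
  refine Finset.sum_nbij' (fun p => (p.1 + p.2, p.1 - p.2))
    (fun p => ((p.1 + p.2) / 2, (p.1 - p.2) / 2)) ?_ ?_ ?_ ?_ ?_
  · intro p hp
    simp only [Finset.mem_filter, mem_diagSolutions one_pos one_pos,
      mem_diagSolutions two_pos two_pos] at hp ⊢
    push_cast at hp ⊢
    exact ⟨by linarith, ⟨p.1, by ring⟩⟩
  · intro p hp
    simp only [Finset.mem_filter, mem_diagSolutions one_pos one_pos,
      mem_diagSolutions two_pos two_pos] at hp ⊢
    obtain ⟨h, c, hc⟩ := hp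
    obtain ⟨x, y⟩ := p
    obtain rfl : x = c + c - y := by simp at hc; omega
    push_cast at h ⊢
    rw [show (c + c - y + y) / 2 = c by omega, show (c + c - y - y) / 2 = c - y by omega]
    linarith
  · intro p _
    ext <;> simp <;> omega
  · intro p hp
    obtain ⟨c, hc⟩ := (Finset.mem_filter.mp hp).2
    ext <;> simp <;> omega
  · intro p _
    simp only [altSign, Int.even_sub]
    split_ifs <;> first | (exfalso; tauto) | ring

end theta

section triple
variable {R : Type*} [CommRing R]

theorem X_pow_dvd_sum_sub_thetaSeries (w : ℤ → R) {D n : ℕ} (h : D ≤ n) :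
    (X : R⟦X⟧) ^ D ∣ ∑ m ∈ Finset.range (2 * n + 1),
      C (w (m - n)) * X ^ (((m : ℤ) - n).natAbs ^ 2) - thetaSeries w 1 := by
  rw [X_pow_dvd_iff]
  intro e he
  rw [map_sub, sub_eq_zero, map_sum,
    coeff_thetaSeries_of_le w one_pos (he.le.trans h)]
  refine Finset.sum_nbij' (fun m => (m : ℤ) - n) (fun k => (k + n).toNat) ?_ ?_ ?_ ?_ ?_
  · intro m hm
    have := Finset.mem_range.mp hm
    simp only [Finset.mem_Icc]
    omega
  · intro k hk
    have := Finset.mem_Icc.mp hk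
    simp only [Finset.mem_range]
    omega
  · intro m _
    simp
  · intro k hk
    have := Finset.mem_Icc.mp hk
    omega
  · intro m _
    rw [coeff_C_mul_X_pow]
    refine if_congr ?_ rfl rfl
    zify
    rw [sq_abs, eq_comm]
    simp

theorem X_pow_dvd_sq_prod_sub_thetaSeries [IsDomain R] {q : R⟦X⟧} (w : ℤ → R) (hq : q ^ 2 = X ^ 2)
    (hw : ∀ k : ℤ, q ^ (k.natAbs ^ 2) = C (w k) * X ^ (k.natAbs ^ 2)) {D n : ℕ} (h : 2 * D ≤ n) :
    X ^ D ∣ (∏ j ∈ Finset.range n, (1 + q ^ (2 * j + 1))) ^ 2 -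
      gaussBinom (X ^ 2) (2 * n) n * thetaSeries w 1 := by
  have hq0 : q ≠ 0 := by
    rintro rfl
    exact pow_ne_zero 2 X_ne_zero (hq.symm.trans (zero_pow two_ne_zero))
  have h1 := (X_pow_dvd_sum_sub_thetaSeries w (show D ≤ n by omega)).mul_left
    (gaussBinom (X ^ 2) (2 * n) n)
  rw [mul_sub, Finset.mul_sum] at h1
  refine (dvd_add ?_ h1).trans (dvd_of_eq (sub_add_sub_cancel _ _ _))
  rw [sq_prod_one_add_pow_odd hq0, hq, ← Finset.sum_sub_distrib]
  refine Finset.dvd_sum fun m _ => ?_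
  rw [hw, ← sub_mul]
  by_cases hm : D ≤ ((m : ℤ) - n).natAbs
  · exact ((pow_dvd_pow X (by nlinarith)).mul_left _).mul_left _
  · refine Dvd.dvd.mul_right ?_ _
    have hX : (X : R⟦X⟧) ^ D ∣ (X ^ 2) ^ D := by
      rw [← pow_mul]
      exact pow_dvd_pow X (by omega)
    refine hX.trans ?_
    rcases le_total m n with hmn | hmn
    · exact pow_dvd_gaussBinom_sub _ hmn (by omega) (by omega)
    · rw [dvd_sub_comm]
      exact pow_dvd_gaussBinom_sub _ hmn (by omega) (by omega)

/-- The finite products approximating `∏ (1 + q ^ (2 * j + 1))` satisfy Gauss' identity relating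
`φ(q)` and `φ(-q)` up to any given order. -/
theorem X_pow_dvd_sq_prod_mul_thetaSeries_sub [IsDomain R] {D n : ℕ} (h : 2 * D ≤ n) :
    (X : R⟦X⟧) ^ D ∣
      (∏ j ∈ Finset.range n, (1 + X ^ (2 * j + 1))) ^ 2 * thetaSeries (altSign R) 1 -
      (∏ j ∈ Finset.range n, (1 - X ^ (2 * j + 1))) ^ 2 * thetaSeries (fun _ => 1) 1 := by
  have h1 := X_pow_dvd_sq_prod_sub_thetaSeries (R := R) (q := X) (fun _ => 1) rfl
    (fun k => by simp) h
  have h2 := X_pow_dvd_sq_prod_sub_thetaSeries (R := R) (q := -X) (altSign R) (by ring)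
    (fun k => by rw [neg_pow, altSign_eq_neg_one_pow]; simp) h
  have h3 : ∏ j ∈ Finset.range n, (1 + (-X : R⟦X⟧) ^ (2 * j + 1)) =
      ∏ j ∈ Finset.range n, (1 - X ^ (2 * j + 1)) :=
    Finset.prod_congr rfl fun j _ => by rw [Odd.neg_pow ⟨j, rfl⟩, sub_eq_add_neg]
  rw [h3] at h2
  refine (dvd_sub (h1.mul_right (thetaSeries (altSign R) 1))
    (h2.mul_right (thetaSeries (fun _ => 1) 1))).trans (dvd_of_eq ?_)
  ring

end triple

section overpartitions
open Nat.Partition Filter Topology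
open scoped PowerSeries.WithPiTopology
variable (R : Type*) [CommRing R]

theorem powerSeriesMk_pbarOdd :
    (PowerSeries.mk fun n => (pbarOdd n : R)) =
      (PowerSeries.mk fun n => ((oddDistincts n).card : R)) *
        PowerSeries.mk fun n => ((odds n).card : R) := by
  ext n
  simp [coeff_mul, pbarOdd, Finset.Nat.sum_antidiagonal_eq_sum_range_succ_mk]

variable [TopologicalSpace R]

/-- The generating function of partitions into distinct odd parts. -/
theorem hasProd_powerSeriesMk_card_oddDistincts [T2Space R] :
    HasProd (fun i => if Odd (i + 1) then 1 + X ^ (i + 1) else 1)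
      (PowerSeries.mk fun n => ((oddDistincts n).card : R)) := by
  convert! hasProd_genFun (fun i c => if Odd i ∧ c = 1 then (1 : R) else 0) using 1
  · ext1 i
    rw [tsum_eq_single 0 (fun j hj => by simp [hj])]
    split_ifs <;> simp_all
  · simp_rw [genFun, oddDistincts, odds, restricted, distincts, ← Finset.filter_and,
      Finset.card_filter, Finsupp.prod, Finset.prod_boole]
    ext n
    simp only [coeff_mk, Nat.cast_sum, Nat.cast_ite, Nat.cast_one, Nat.cast_zero]
    refine Finset.sum_congr rfl fun p _ => if_congr ?_ rfl rfl
    simp only [Multiset.toFinsupp_support, Multiset.mem_toFinset, Multiset.toFinsupp_apply,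
      Nat.not_even_iff_odd, Multiset.nodup_iff_count_eq_one]
    exact ⟨fun h i hi => ⟨h.1 i hi, h.2 i hi⟩, fun h => ⟨fun i hi => (h i hi).1,
      fun i hi => (h i hi).2⟩⟩

theorem sq_powerSeriesMk_pbarOdd_mul_thetaSeries [IsTopologicalRing R] [T2Space R] [IsDomain R] :
    (PowerSeries.mk fun n => (pbarOdd n : R)) ^ 2 * thetaSeries (altSign R) 1 =
      thetaSeries (fun _ => 1) 1 := by
  set F : ℕ → R⟦X⟧ := fun i => if Odd (i + 1) then 1 + X ^ (i + 1) else 1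
  set G : ℕ → R⟦X⟧ := fun i => if ¬ Even (i + 1) then ∑' j : ℕ, X ^ ((i + 1) * j) else 1
  have hF : ∀ n, ∏ i ∈ Finset.range (2 * n), F i = ∏ j ∈ Finset.range n, (1 + X ^ (2 * j + 1)) := by
    intro n
    induction n with
    | zero => simp
    | succ n ih =>
      rw [show 2 * (n + 1) = 2 * n + 1 + 1 by ring, Finset.prod_range_succ, Finset.prod_range_succ,
        ih, Finset.prod_range_succ]
      simp [F, parity_simps]
  have hG : ∀ n, (∏ i ∈ Finset.range (2 * n), G i) *
      ∏ j ∈ Finset.range n, (1 - X ^ (2 * j + 1)) = 1 := by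
    intro n
    induction n with
    | zero => simp
    | succ n ih =>
      rw [show 2 * (n + 1) = 2 * n + 1 + 1 by ring, Finset.prod_range_succ, Finset.prod_range_succ,
        Finset.prod_range_succ, show G (2 * n + 1) = 1 by simp [G, parity_simps],
        show G (2 * n) = ∑' j : ℕ, (X ^ (2 * n + 1)) ^ j by simp [G, parity_simps, pow_mul]]
      have := WithPiTopology.tsum_pow_mul_one_sub_of_constantCoeff_eq_zero
        (f := (X : R⟦X⟧) ^ (2 * n + 1)) (by simp)
      linear_combination ih + (∏ i ∈ Finset.range (2 * n), G i) *
        (∏ j ∈ Finset.range n, (1 - X ^ (2 * j + 1))) * this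
  have h2 : Tendsto (fun n : ℕ => 2 * n) atTop atTop := tendsto_id.const_mul_atTop' two_pos
  have hlimF := (hasProd_powerSeriesMk_card_oddDistincts R).tendsto_prod_nat.comp h2
  have hlimG := (hasProd_powerSeriesMk_card_restricted R (¬ Even ·)).tendsto_prod_nat.comp h2
  have hlim := (((hlimF.mul hlimG).pow 2).mul_const (thetaSeries (altSign R) 1)).sub_const
    (thetaSeries (fun _ => 1) 1)
  rw [powerSeriesMk_pbarOdd, ← sub_eq_zero]
  refine tendsto_nhds_unique hlim ?_
  rw [WithPiTopology.tendsto_iff_coeff_tendsto]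
  refine fun d => tendsto_atTop_of_eventually_const (i₀ := 2 * (d + 1)) fun n hn => ?_
  have hdvd := (X_pow_dvd_sq_prod_mul_thetaSeries_sub (R := R) hn).mul_left
    ((∏ i ∈ Finset.range (2 * n), G i) ^ 2)
  rw [map_zero]
  refine X_pow_dvd_iff.mp (hdvd.trans (dvd_of_eq ?_)) d (Nat.lt_succ_self d)
  simp only [Function.comp_apply]
  change _ = ((∏ i ∈ Finset.range (2 * n), F i) * ∏ i ∈ Finset.range (2 * n), G i) ^ 2 * _ - _
  rw [hF]
  linear_combination (-thetaSeries (fun _ => 1) 1 * ((∏ i ∈ Finset.range (2 * n), G i) *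
      ∏ j ∈ Finset.range n, (1 - X ^ (2 * j + 1)) + 1)) * hG n

/-- The generating function of overpartitions into odd parts is `φ(-q²) / φ(-q)`. -/
theorem powerSeriesMk_pbarOdd_mul_thetaSeries [IsTopologicalRing R] [T2Space R] [IsDomain R]
    (h2 : (2 : R) ≠ 0) :
    (PowerSeries.mk fun n => (pbarOdd n : R)) * thetaSeries (altSign R) 1 =
      thetaSeries (altSign R) 2 := by
  have h : ((PowerSeries.mk fun n => (pbarOdd n : R)) * thetaSeries (altSign R) 1) ^ 2 =
      thetaSeries (altSign R) 2 ^ 2 := by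
    rw [← thetaSeries_mul_thetaSeries_altSign, ← sq_powerSeriesMk_pbarOdd_mul_thetaSeries]
    ring
  refine (sq_eq_sq_iff_eq_or_eq_neg.mp h).resolve_right fun hneg => h2 ?_
  have hc := congrArg constantCoeff hneg
  have h0 : pbarOdd 0 = 1 := by decide
  rw [map_mul, map_neg, constantCoeff_thetaSeries_altSign, constantCoeff_thetaSeries_altSign,
    ← coeff_zero_eq_constantCoeff_apply, coeff_mk, h0] at hc
  linear_combination hc

end overpartitions

section trisection
variable {R : Type*} [CommRing R]

/-- The series whose coefficients are those of index divisible by three. -/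
noncomputable def trisect : R⟦X⟧ →ₗ[R] R⟦X⟧ where
  toFun F := mk fun n => coeff (3 * n) F
  map_add' F G := by ext; simp
  map_smul' r F := by ext; simp

@[simp] theorem coeff_trisect (F : R⟦X⟧) (n : ℕ) :
    coeff n (trisect F) = coeff (3 * n) F := by
  simp [trisect]

theorem trisect_mul_expand (F G : R⟦X⟧) :
    trisect (F * expand 3 three_ne_zero G) = trisect F * G := by
  ext n
  rw [coeff_trisect, coeff_mul, coeff_mul]
  symm
  refine Finset.sum_of_injOn (fun p => (3 * p.1, 3 * p.2)) ?_ ?_ ?_ ?_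
  · rintro ⟨a, b⟩ _ ⟨c, d⟩ _ h
    simp only [Prod.mk.injEq] at h ⊢
    omega
  · rintro ⟨a, b⟩ h
    simp only [Finset.mem_coe, Finset.HasAntidiagonal.mem_antidiagonal] at h ⊢
    omega
  · rintro ⟨a, b⟩ h hn
    rw [coeff_expand, if_neg, mul_zero]
    rintro ⟨d, rfl⟩
    rw [Finset.HasAntidiagonal.mem_antidiagonal] at h
    refine hn ⟨(n - d, d), ?_, ?_⟩
    · simp only [Finset.mem_coe, Finset.HasAntidiagonal.mem_antidiagonal]
      omega
    · simp only [Prod.mk.injEq, and_true]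
      omega
  · rintro ⟨a, b⟩ _
    simp [coeff_expand]

theorem coeff_thetaSeries_eq_zero (w : ℤ → R) {d n : ℕ} (h : ∀ k : ℤ, (d : ℤ) * k ^ 2 ≠ n) :
    coeff n (thetaSeries w d) = 0 := by
  rw [thetaSeries, coeff_mk]
  exact Finset.sum_eq_zero fun k _ => if_neg (h k)

theorem coeff_thetaSeries_altSign_of_mod_three_eq_two {n : ℕ} (h : n % 3 = 2) :
    coeff n (thetaSeries (altSign R) 1) = 0 :=
  coeff_thetaSeries_eq_zero _ fun k hk => by
    have h3 : k % 3 = 0 ∨ k % 3 = 1 ∨ k % 3 = 2 := by omega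
    have : (n : ℤ) % 3 = k ^ 2 % 3 := by rw [← hk]; simp
    rcases h3 with h3 | h3 | h3 <;> simp [sq, Int.mul_emod, h3] at this <;> omega

theorem coeff_thetaSeries_altSign_two_of_mod_three_eq_one {n : ℕ} (h : n % 3 = 1) :
    coeff n (thetaSeries (altSign R) 2) = 0 :=
  coeff_thetaSeries_eq_zero _ fun k hk => by
    have h3 : k % 3 = 0 ∨ k % 3 = 1 ∨ k % 3 = 2 := by omega
    have : (n : ℤ) % 3 = (2 * k ^ 2) % 3 := by rw [← hk]; simp
    rcases h3 with h3 | h3 | h3 <;> simp [sq, Int.mul_emod, h3] at this <;> omega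

theorem altSign_three_mul (k : ℤ) : altSign R (3 * k) = altSign R k := by
  simp [altSign, Int.even_mul, show ¬ Even (3 : ℤ) by decide]

theorem thetaSeries_three_mul (w : ℤ → R) {d : ℕ} (hd : 0 < d) :
    thetaSeries w (3 * d) = expand 3 three_ne_zero (thetaSeries w d) := by
  ext n
  rw [coeff_expand]
  split_ifs with h
  · obtain ⟨m, rfl⟩ := h
    rw [coeff_thetaSeries_of_le w (by omega) le_rfl,
      coeff_thetaSeries_of_le w hd (show 3 * m / 3 ≤ 3 * m by omega)]
    refine Finset.sum_congr rfl fun k _ => if_congr ?_ rfl rfl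
    rw [Nat.mul_div_cancel_left _ (by norm_num)]
    push_cast
    rw [mul_assoc]
    omega
  · refine coeff_thetaSeries_eq_zero w fun k hk => h ?_
    zify
    exact ⟨d * k ^ 2, by rw [← hk]; push_cast; ring⟩

theorem trisect_thetaSeries_altSign {d : ℕ} (hd : 0 < d) (h3 : ¬ 3 ∣ d) :
    trisect (thetaSeries (altSign R) d) = thetaSeries (altSign R) (3 * d) := by
  ext n
  rw [coeff_trisect, coeff_thetaSeries_of_le _ hd le_rfl,
    coeff_thetaSeries_of_le _ (show 0 < 3 * d by omega) le_rfl, ← Finset.sum_filter,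
    ← Finset.sum_filter]
  symm
  refine Finset.sum_nbij (fun k => 3 * k) ?_ ?_ ?_ ?_
  · intro k hk
    simp only [Finset.mem_filter, Finset.mem_Icc] at hk ⊢
    push_cast at hk ⊢
    exact ⟨by omega, by linarith⟩
  · intro a _ b _ h
    simpa using h
  · intro k hk
    simp only [Finset.mem_coe, Finset.mem_filter, Finset.mem_Icc] at hk
    obtain ⟨hk, he⟩ := hk
    have hp : Prime (3 : ℤ) := Int.prime_three
    obtain ⟨m, rfl⟩ : (3 : ℤ) ∣ k := by
      refine hp.dvd_of_dvd_pow (n := 2) ((hp.dvd_or_dvd (a := (d : ℤ)) ?_).resolve_left ?_)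
      · exact ⟨n, by rw [he]; push_cast; ring⟩
      · exact_mod_cast h3
    refine ⟨m, ?_, rfl⟩
    simp only [Finset.mem_coe, Finset.mem_filter, Finset.mem_Icc]
    push_cast at hk he ⊢
    exact ⟨by omega, by linarith⟩
  · intro k _
    rw [altSign_three_mul]

/-- A trisection of `φ(-q) φ(-q²)`, which reflects the splitting of `3` in `ℤ[√-2]`. -/
theorem trisect_thetaSeries_mul_add :
    trisect (thetaSeries (altSign R) 1 * thetaSeries (altSign R) 2) +
        thetaSeries (altSign R) 3 * thetaSeries (altSign R) 6 =
      2 * (thetaSeries (fun _ => 1) 1 * thetaSeries (altSign R) 2) := by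
  have h6 : 0 < 6 := by norm_num
  ext n
  rw [map_add, coeff_trisect, two_mul, map_add, coeff_thetaSeries_mul _ _ one_pos two_pos,
    coeff_thetaSeries_mul _ _ one_pos two_pos, coeff_thetaSeries_mul _ _ three_pos h6]
  set S := diagSolutions 1 2 (3 * n)
  set A := S.filter fun p : ℤ × ℤ => 3 ∣ p.1 - p.2
  set B := S.filter fun p : ℤ × ℤ => 3 ∣ p.1 + p.2
  have hS : ∀ p : ℤ × ℤ, p ∈ S ↔ p.1 ^ 2 + 2 * p.2 ^ 2 = 3 * n := by
    intro p
    rw [mem_diagSolutions one_pos two_pos]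
    push_cast
    rw [one_mul]
  have hAB : S = A ∪ B := by
    rw [← Finset.filter_or, Finset.filter_true_of_mem]
    intro p hp
    refine Int.prime_three.dvd_or_dvd ⟨n - p.2 ^ 2, ?_⟩
    linear_combination (hS p).mp hp
  have hinter : ∑ p ∈ diagSolutions 3 6 n, altSign R p.1 * altSign R p.2 =
      ∑ p ∈ A ∩ B, altSign R p.1 * altSign R p.2 := by
    refine Finset.sum_nbij' (fun p => (3 * p.1, 3 * p.2)) (fun p => (p.1 / 3, p.2 / 3))
      ?_ ?_ ?_ ?_ ?_
    · intro p hp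
      simp only [A, B, Finset.mem_inter, Finset.mem_filter, hS, mem_diagSolutions three_pos h6]
        at hp ⊢
      push_cast at hp
      exact ⟨⟨by linarith, by omega⟩, ⟨by linarith, by omega⟩⟩
    · rintro ⟨x, y⟩ hp
      simp only [A, B, Finset.mem_inter, Finset.mem_filter, hS, mem_diagSolutions three_pos h6]
        at hp ⊢
      obtain ⟨⟨h, h1⟩, _, h2⟩ := hp
      obtain ⟨u, rfl⟩ : 3 ∣ x := by omega
      obtain ⟨v, rfl⟩ : 3 ∣ y := by omega
      simp only [ne_eq, OfNat.ofNat_ne_zero, not_false_eq_true, Int.mul_ediv_cancel_left]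
      push_cast
      linarith
    · intro p _
      simp
    · rintro ⟨x, y⟩ hp
      simp only [A, B, Finset.mem_inter, Finset.mem_filter] at hp
      ext <;> simp <;> omega
    · intro p _
      rw [altSign_three_mul, altSign_three_mul]
  have hA : ∑ p ∈ A, altSign R p.1 * altSign R p.2 =
      ∑ p ∈ diagSolutions 1 2 n, 1 * altSign R p.2 := by
    symm
    refine Finset.sum_nbij' (fun p => (p.1 + 2 * p.2, p.1 - p.2))
      (fun p => ((p.1 + 2 * p.2) / 3, (p.1 - p.2) / 3)) ?_ ?_ ?_ ?_ ?_
    · intro p hp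
      simp only [A, Finset.mem_filter, hS, mem_diagSolutions one_pos two_pos] at hp ⊢
      push_cast at hp
      exact ⟨by linarith, by omega⟩
    · rintro ⟨x, y⟩ hp
      simp only [A, Finset.mem_filter, hS, mem_diagSolutions one_pos two_pos] at hp ⊢
      obtain ⟨h, t, ht⟩ := hp
      obtain rfl : x = y + 3 * t := by omega
      rw [show (y + 3 * t + 2 * y) / 3 = y + t by omega, show (y + 3 * t - y) / 3 = t by omega]
      push_cast
      linarith
    · intro p _
      ext <;> simp <;> omega
    · intro p hp
      have := (Finset.mem_filter.mp hp).2
      ext <;> simp <;> omega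
    · intro p _
      simp only [altSign, Int.even_sub, Int.even_add, even_two, Even.mul_right, iff_true]
      split_ifs <;> first | (exfalso; tauto) | ring
  have hB : ∑ p ∈ B, altSign R p.1 * altSign R p.2 =
      ∑ p ∈ A, altSign R p.1 * altSign R p.2 := by
    refine Finset.sum_nbij' (fun p => (p.1, -p.2)) (fun p => (p.1, -p.2)) ?_ ?_ ?_ ?_ ?_
    · intro p hp
      simp only [A, B, Finset.mem_filter, hS] at hp ⊢
      exact ⟨by linarith, by omega⟩
    · intro p hp
      simp only [A, B, Finset.mem_filter, hS] at hp ⊢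
      exact ⟨by linarith, by omega⟩
    · intro p _
      simp
    · intro p _
      simp
    · intro p _
      simp [altSign]
  rw [hinter, hAB, Finset.sum_union_inter, hB, hA]

/-- `φ(-q) - φ(-q⁹)` consists of the terms of `φ(-q)` whose exponents are `1` modulo `3`. -/
theorem coeff_thetaSeries_sub_expand_trisect {n : ℕ} (h : n % 3 ≠ 1) :
    coeff n (thetaSeries (altSign R) 1 -
      expand 3 three_ne_zero (trisect (thetaSeries (altSign R) 1))) = 0 := by
  rw [map_sub, coeff_expand]
  split_ifs with hn
  · rw [coeff_trisect, Nat.mul_div_cancel' hn, sub_self]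
  · rw [coeff_thetaSeries_altSign_of_mod_three_eq_two (by omega), sub_zero]

theorem coeff_mul_eq_zero {F G : R⟦X⟧} {n : ℕ}
    (h : ∀ i j, i + j = n → coeff i F = 0 ∨ coeff j G = 0) : coeff n (F * G) = 0 := by
  rw [coeff_mul]
  refine Finset.sum_eq_zero fun p hp => ?_
  rcases h p.1 p.2 (Finset.HasAntidiagonal.mem_antidiagonal.mp hp) with h | h <;> rw [h] <;> simp

theorem trisect_sq_mul_thetaSeries :
    trisect (thetaSeries (altSign R) 1 ^ 2 * thetaSeries (altSign R) 2) =
      thetaSeries (altSign R) 3 *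
        (2 * trisect (thetaSeries (altSign R) 1 * thetaSeries (altSign R) 2) -
          thetaSeries (altSign R) 3 * thetaSeries (altSign R) 6) := by
  set a := thetaSeries (altSign R) 1
  set b := thetaSeries (altSign R) 2
  have ha : trisect a = thetaSeries (altSign R) 3 :=
    trisect_thetaSeries_altSign one_pos (by norm_num)
  have hb : trisect b = thetaSeries (altSign R) 6 :=
    trisect_thetaSeries_altSign two_pos (by norm_num)
  set E := expand 3 three_ne_zero (trisect a)
  have h0 : trisect ((a - E) * ((a - E) * b)) = 0 := by
    ext n
    rw [coeff_trisect, map_zero]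
    refine coeff_mul_eq_zero fun i j hij => or_iff_not_imp_left.mpr fun hi => ?_
    have hi1 : i % 3 = 1 := of_not_not fun h => hi (coeff_thetaSeries_sub_expand_trisect h)
    refine coeff_mul_eq_zero fun k l hkl => or_iff_not_imp_left.mpr fun hk => ?_
    have hk1 : k % 3 = 1 := of_not_not fun h => hk (coeff_thetaSeries_sub_expand_trisect h)
    exact coeff_thetaSeries_altSign_two_of_mod_three_eq_one (by omega)
  have h1 : a ^ 2 * b = (a - E) * ((a - E) * b) + (a * b) * E + (a * b) * E -
      b * expand 3 three_ne_zero (trisect a * trisect a) := by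
    rw [map_mul]
    ring
  rw [h1, map_sub, map_add, map_add, h0, trisect_mul_expand, trisect_mul_expand, hb, ha]
  ring

end trisection

section modThree

theorem cube_eq_expand (F : (ZMod 3)⟦X⟧) : F ^ 3 = expand 3 three_ne_zero F := by
  have h := MvPowerSeries.map_frobenius_expand (σ := Unit) (R := ZMod 3) 3 three_ne_zero (f := F)
  rw [ZMod.frobenius_zmod, MvPowerSeries.map_id] at h
  exact h.symm

/-- Modulo three, the generating function of `pbarOdd (3 * n)` is `φ(-q) φ(-q⁶)`. -/
theorem trisect_powerSeriesMk_pbarOdd :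
    trisect (PowerSeries.mk fun n => (pbarOdd n : ZMod 3)) =
      thetaSeries (altSign (ZMod 3)) 1 * thetaSeries (altSign (ZMod 3)) 6 := by
  set P := PowerSeries.mk fun n => (pbarOdd n : ZMod 3)
  set a := thetaSeries (altSign (ZMod 3)) 1 with ha
  set b := thetaSeries (altSign (ZMod 3)) 2
  set f := thetaSeries (fun _ => (1 : ZMod 3)) 1
  have ha0 : a ≠ 0 := fun h => by
    have := constantCoeff_thetaSeries_altSign (R := ZMod 3) 1
    rw [← ha, h] at this
    simp at this
  have hP : P * a = b := powerSeriesMk_pbarOdd_mul_thetaSeries (ZMod 3) (by decide)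
  have hf : f * a = b ^ 2 := thetaSeries_mul_thetaSeries_altSign
  have h3 : thetaSeries (altSign (ZMod 3)) 3 = a ^ 3 := by
    rw [cube_eq_expand, ← thetaSeries_three_mul _ one_pos, mul_one]
  have h6 : thetaSeries (altSign (ZMod 3)) 6 = b ^ 3 := by
    rw [cube_eq_expand, ← thetaSeries_three_mul _ two_pos, show 3 * 2 = 6 by norm_num]
  have hL : trisect (a * b) + a ^ 3 * b ^ 3 = 2 * (f * b) := by
    rw [← h3, ← h6]
    exact trisect_thetaSeries_mul_add
  have hU : trisect (a ^ 2 * b) = a ^ 3 * (2 * trisect (a * b) - a ^ 3 * b ^ 3) := by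
    rw [← h3, ← h6]
    exact trisect_sq_mul_thetaSeries
  have hPa : trisect P * a = trisect (a ^ 2 * b) := by
    rw [← trisect_mul_expand, ← cube_eq_expand, ← hP]
    congr 1
    ring
  have hthree : (3 : (ZMod 3)⟦X⟧) = 0 := by
    have h : (3 : ZMod 3) = 0 := by decide
    rw [← map_ofNat (C (R := ZMod 3)) 3, ← map_zero (C (R := ZMod 3))]
    exact congrArg _ h
  rw [h6]
  refine mul_right_cancel₀ ha0 ?_
  rw [hPa, hU]
  linear_combination 2 * a ^ 3 * hL + a ^ 2 * b * hf +
    (a ^ 3 * f * b - a ^ 6 * b ^ 3) * hthree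

theorem coeff_trisect_powerSeriesMk_pbarOdd_of_mod_three_eq_two {n : ℕ} (h : n % 3 = 2) :
    coeff n (trisect (PowerSeries.mk fun n => (pbarOdd n : ZMod 3))) = 0 := by
  rw [trisect_powerSeriesMk_pbarOdd, show 6 = 3 * 2 by norm_num, thetaSeries_three_mul _ two_pos]
  refine coeff_mul_eq_zero fun i j hij => or_iff_not_imp_right.mpr fun hj => ?_
  rw [coeff_expand] at hj
  have hj3 : 3 ∣ j := of_not_not fun h => hj (if_neg h)
  exact coeff_thetaSeries_altSign_of_mod_three_eq_two (by omega)

theorem trisect_trisect_trisect_powerSeriesMk_pbarOdd :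
    trisect (trisect (trisect (PowerSeries.mk fun n => (pbarOdd n : ZMod 3)))) =
      trisect (PowerSeries.mk fun n => (pbarOdd n : ZMod 3)) := by
  have h6 : thetaSeries (altSign (ZMod 3)) 6 =
      expand 3 three_ne_zero (thetaSeries (altSign (ZMod 3)) 2) :=
    thetaSeries_three_mul _ two_pos
  have h3 : thetaSeries (altSign (ZMod 3)) 3 =
      expand 3 three_ne_zero (thetaSeries (altSign (ZMod 3)) 1) :=
    thetaSeries_three_mul _ one_pos
  rw [trisect_powerSeriesMk_pbarOdd, h6, trisect_mul_expand,
    trisect_thetaSeries_altSign one_pos (by norm_num), mul_one, h3, mul_comm, trisect_mul_expand,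
    trisect_thetaSeries_altSign two_pos (by norm_num), mul_comm, thetaSeries_three_mul _ two_pos]

theorem pbarOdd_twenty_seven_mul (n : ℕ) :
    (pbarOdd (27 * n) : ZMod 3) = pbarOdd (3 * n) := by
  have h := congrArg (coeff n) trisect_trisect_trisect_powerSeriesMk_pbarOdd
  simp only [coeff_trisect, coeff_mk] at h
  rw [← h]
  ring_nf

end modThree

theorem pbarOdd_cong_9_6 (n α : ℕ) :
    pbarOdd (3 ^ (2 * α) * (9 * n + 6)) ≡ 0 [MOD 3] := by
  rw [← ZMod.natCast_eq_natCast_iff, Nat.cast_zero]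
  induction α with
  | zero =>
    have h := coeff_trisect_powerSeriesMk_pbarOdd_of_mod_three_eq_two
      (show (3 * n + 2) % 3 = 2 by omega)
    rw [coeff_trisect, coeff_mk] at h
    rw [← h]
    ring_nf
  | succ α ih =>
    rw [show 3 ^ (2 * (α + 1)) * (9 * n + 6) = 27 * (3 ^ (2 * α) * (3 * n + 2)) by ring,
      pbarOdd_twenty_seven_mul, ← ih]
    ring_nf
end

section
/- For all integers n ≥ 0 and α ≥ 0, ped(3^{2α+2}·n + (19·3^{2α+1} − 1)/8) ≡ 0 (mod 3). -/
/-- `ped n`: number of partitions of `n` in which even parts are not repeated. -/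
noncomputable def ped (n : ℕ) : ℕ :=
  Nat.card {p : n.Partition // ∀ i, Even i → p.parts.count i ≤ 1}

namespace Ped

open Finset PowerSeries

section FiniteIdentities

variable {R : Type*} [CommRing R] (x : R)

theorem sum_alternating_square_step (u : ℕ → R) (hu : ∀ k, (1 + x ^ k) * u k = 1) (n m : ℕ)
    (hm : m ≤ n) :
    ∑ s ∈ range (m + 1), ((-1) ^ s * (∏ k ∈ Ico s (n + 1), (1 - x ^ (k + 1)) * u (k + 1)) *
        x ^ (s * (n + 1 + 1)) * (2 * u s) -
      (-1) ^ s * (∏ k ∈ Ico s n, (1 - x ^ (k + 1)) * u (k + 1)) * x ^ (s * (n + 1)) * (2 * u s)) =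
    2 * u (n + 1) * ((-1) ^ (m + 1) * (∏ k ∈ Ico m n, (1 - x ^ (k + 1)) * u (k + 1)) *
      x ^ ((m + 1) * (n + 1))) := by
  have hn := hu (n + 1)
  induction m with
  | zero =>
    have h0 := hu 0
    rw [sum_range_one, prod_Ico_succ_top (Nat.zero_le n)]
    generalize ∏ k ∈ Ico 0 n, (1 - x ^ (k + 1)) * u (k + 1) = Q
    simp only [pow_zero, zero_mul, zero_add, one_mul, pow_one, mul_one] at *
    linear_combination (Q * (1 - x ^ (n + 1)) * u (n + 1) - Q) * h0 + Q * hn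
  | succ m ih =>
    have hm' := hu (m + 1)
    rw [sum_range_succ, ih (by omega), prod_Ico_succ_top hm,
      prod_eq_prod_Ico_succ_bot (show m < n by omega)]
    generalize ∏ k ∈ Ico (m + 1) n, (1 - x ^ (k + 1)) * u (k + 1) = Q
    rw [show (m + 1) * (n + 1 + 1) = (m + 1) * (n + 1) + (m + 1) by ring,
      show (m + 1 + 1) * (n + 1) = (m + 1) * (n + 1) + (n + 1) by ring, pow_add _ _ (m + 1),
      pow_add _ _ (n + 1), pow_succ (-1 : R) (m + 1), pow_succ (-1 : R) m]
    generalize x ^ ((m + 1) * (n + 1)) = z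
    generalize x ^ (m + 1) = y at *
    generalize x ^ (n + 1) = w at *
    generalize (-1 : R) ^ m = e
    linear_combination 2 * e * Q * z * (u (n + 1) * w * hm' - u (m + 1) * hn)

/-- A finite form of Gauss's identity `∑ (-1)^s x^(s^2) = ∏ (1 - x^k) / (1 + x^k)`. -/
theorem sum_alternating_square (u : ℕ → R) (hu : ∀ k, (1 + x ^ k) * u k = 1) (n : ℕ) :
    ∑ s ∈ range (n + 1), (-1) ^ s * (∏ k ∈ Ico s n, (1 - x ^ (k + 1)) * u (k + 1)) *
      x ^ (s * (n + 1)) * (2 * u s) =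
    1 + 2 * ∑ s ∈ range n, (-1) ^ (s + 1) * x ^ ((s + 1) ^ 2) := by
  induction n with
  | zero =>
    have h0 := hu 0
    simp only [pow_zero] at h0
    simp
    linear_combination h0
  | succ n ih =>
    have h := sum_alternating_square_step x u hu n n le_rfl
    rw [sum_sub_distrib, ih] at h
    have hn := hu (n + 1)
    rw [sum_range_succ, sub_eq_iff_eq_add.mp h, sum_range_succ _ n]
    simp only [Ico_self, prod_empty]
    rw [show (n + 1) * (n + 1 + 1) = (n + 1) ^ 2 + (n + 1) by ring, pow_add,
      show (n + 1) * (n + 1) = (n + 1) ^ 2 by ring]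
    linear_combination 2 * (-1) ^ (n + 1) * x ^ ((n + 1) ^ 2) * hn

theorem sum_triangular_step (v : ℕ → R) (hv : ∀ k, (1 - x ^ (2 * k + 1)) * v k = 1) (n m : ℕ)
    (hm : m ≤ n) :
    ∑ s ∈ range (m + 1), ((∏ k ∈ Ico s (n + 1), (1 - x ^ (2 * k + 2)) * v k) *
        x ^ (s * (2 * (n + 1) + 1)) -
      (∏ k ∈ Ico s n, (1 - x ^ (2 * k + 2)) * v k) * x ^ (s * (2 * n + 1))) =
    v n * (∏ k ∈ Ico m n, (1 - x ^ (2 * k + 2)) * v k) * (1 - x ^ (2 * m + 1)) *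
      x ^ ((m + 1) * (2 * n + 1)) := by
  have hn := hv n
  induction m with
  | zero =>
    rw [sum_range_one, prod_Ico_succ_top (Nat.zero_le n)]
    generalize ∏ k ∈ Ico 0 n, (1 - x ^ (2 * k + 2)) * v k = Q
    simp only [zero_mul, pow_zero, mul_zero, zero_add, one_mul, pow_one] at *
    linear_combination Q * hn
  | succ m ih =>
    have hm' := hv m
    rw [sum_range_succ, ih (by omega), prod_Ico_succ_top hm,
      prod_eq_prod_Ico_succ_bot (show m < n by omega)]
    generalize ∏ k ∈ Ico (m + 1) n, (1 - x ^ (2 * k + 2)) * v k = Q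
    rw [show (m + 1) * (2 * (n + 1) + 1) = (m + 1) * (2 * n + 1) + (2 * m + 2) by ring,
      show (m + 1 + 1) * (2 * n + 1) = (m + 1) * (2 * n + 1) + (2 * n + 1) by ring,
      show 2 * (m + 1) + 1 = (2 * m + 2) + 1 by ring, show 2 * n + 2 = 2 * n + 1 + 1 by ring,
      pow_add _ _ (2 * m + 2), pow_add _ _ (2 * n + 1), pow_succ x (2 * m + 2),
      pow_succ x (2 * n + 1)]
    generalize x ^ ((m + 1) * (2 * n + 1)) = z
    generalize x ^ (2 * m + 1) = y at *
    generalize x ^ (2 * m + 2) = y' at *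
    generalize x ^ (2 * n + 1) = w at *
    linear_combination Q * z * hn + v n * Q * (1 - y') * z * hm'

/-- A finite form of Gauss's identity `∑ x^(s(s+1)/2) = ∏ (1 - x^(2k)) / (1 - x^(2k-1))`. -/
theorem sum_triangular (v : ℕ → R) (hv : ∀ k, (1 - x ^ (2 * k + 1)) * v k = 1) (n : ℕ) :
    ∑ s ∈ range (n + 1), (∏ k ∈ Ico s n, (1 - x ^ (2 * k + 2)) * v k) * x ^ (s * (2 * n + 1)) =
    ∑ s ∈ range (2 * n + 1), x ^ (s * (s + 1) / 2) := by
  induction n with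
  | zero => simp
  | succ n ih =>
    have h := sum_triangular_step x v hv n n le_rfl
    rw [sum_sub_distrib, ih] at h
    have hn := hv n
    rw [sum_range_succ, sub_eq_iff_eq_add.mp h, show 2 * (n + 1) + 1 = 2 * n + 1 + 1 + 1 by ring,
      sum_range_succ _ (2 * n + 1 + 1), sum_range_succ _ (2 * n + 1)]
    simp only [Ico_self, prod_empty]
    rw [show (2 * n + 1) * (2 * n + 1 + 1) = 2 * ((n + 1) * (2 * n + 1)) by ring,
      show (2 * n + 1 + 1) * (2 * n + 1 + 1 + 1) = 2 * ((n + 1) * (2 * n + 1 + 1 + 1)) by ring,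
      Nat.mul_div_cancel_left _ two_pos, Nat.mul_div_cancel_left _ two_pos]
    linear_combination x ^ ((n + 1) * (2 * n + 1)) * hn

end FiniteIdentities

section ThetaSeries

variable {ι κ μ : Type*}

/-- The series `∑ X ^ Q v` over all `v`, with coefficients in `ZMod 3`; it is meaningful
when `Q` has finite fibers. -/
noncomputable def theta (Q : ι → ℕ) : (ZMod 3)⟦X⟧ :=
  PowerSeries.mk fun n ↦ (Nat.card {v // Q v = n} : ZMod 3)

theorem coeff_theta (Q : ι → ℕ) (n : ℕ) :
    coeff n (theta Q) = (Nat.card {v // Q v = n} : ZMod 3) := coeff_mk _ _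

theorem coeff_theta_eq_zero {Q : ι → ℕ} {n : ℕ} (h : ∀ v, Q v ≠ n) : coeff n (theta Q) = 0 := by
  have : IsEmpty {v // Q v = n} := ⟨fun v ↦ h v.1 v.2⟩
  simp [coeff_theta]

/-- A point of the fiber of `Q + S` over `n` amounts to a decomposition of `n` and a pair of points
in the corresponding fibers of `Q` and `S`. -/
def fiberAddEquiv (Q : ι → ℕ) (S : κ → ℕ) (n : ℕ) : {p : ι × κ // Q p.1 + S p.2 = n} ≃
    Σ a : antidiagonal n, {v // Q v = a.1.1} × {w // S w = a.1.2} where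
  toFun p := ⟨⟨(Q p.1.1, S p.1.2), by simpa using p.2⟩, ⟨p.1.1, rfl⟩, ⟨p.1.2, rfl⟩⟩
  invFun z := ⟨(z.2.1.1, z.2.2.1), (congrArg₂ (· + ·) z.2.1.2 z.2.2.2).trans
    (HasAntidiagonal.mem_antidiagonal.mp z.1.2)⟩
  left_inv p := rfl
  right_inv := by
    rintro ⟨⟨⟨a, b⟩, h⟩, ⟨v, hv⟩, ⟨w, hw⟩⟩
    change Q v = a at hv
    change S w = b at hw
    subst hv hw
    rfl

theorem finite_fiber_add {Q : ι → ℕ} {S : κ → ℕ} (hQ : ∀ n, Finite {v // Q v = n})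
    (hS : ∀ n, Finite {v // S v = n}) (n : ℕ) : Finite {p : ι × κ // Q p.1 + S p.2 = n} :=
  Finite.of_equiv _ (fiberAddEquiv Q S n).symm

theorem theta_add {Q : ι → ℕ} {S : κ → ℕ} (hQ : ∀ n, Finite {v // Q v = n})
    (hS : ∀ n, Finite {v // S v = n}) :
    theta (fun p : ι × κ ↦ Q p.1 + S p.2) = theta Q * theta S := by
  ext n
  rw [coeff_mul, coeff_theta, Nat.card_congr (fiberAddEquiv Q S n), Nat.card_sigma,
    ← Finset.sum_coe_sort (antidiagonal n)]
  simp [coeff_theta, Nat.card_prod]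

theorem theta_eq_add_of_bijective {Q : ι → ℕ} (hQ : ∀ n, Finite {v // Q v = n}) (f : κ → ι)
    (g : μ → ι) (h : Function.Bijective (Sum.elim f g)) :
    theta Q = theta (fun v ↦ Q (f v)) + theta (fun v ↦ Q (g v)) := by
  ext n
  have := hQ n
  have : Finite {v // Q (Sum.elim f g (.inl v)) = n} :=
    Finite.of_injective (fun v ↦ (⟨f v.1, v.2⟩ : {v // Q v = n})) fun v w hvw ↦
      Subtype.ext (Sum.inl_injective (h.1 (congrArg Subtype.val hvw)))
  have : Finite {v // Q (Sum.elim f g (.inr v)) = n} :=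
    Finite.of_injective (fun v ↦ (⟨g v.1, v.2⟩ : {v // Q v = n})) fun v w hvw ↦
      Subtype.ext (Sum.inr_injective (h.1 (congrArg Subtype.val hvw)))
  let e : {v // Q (Sum.elim f g v) = n} ≃ {v // Q v = n} :=
    (Equiv.ofBijective _ h).subtypeEquiv fun v ↦ Iff.rfl
  rw [map_add, coeff_theta, coeff_theta, coeff_theta, ← Nat.card_congr e,
    Nat.card_congr Equiv.subtypeSum, Nat.card_sum, Nat.cast_add]
  rfl

theorem theta_mul_left (d : ℕ) (hd : d ≠ 0) (Q : ι → ℕ) :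
    theta (fun v ↦ d * Q v) = expand d hd (theta Q) := by
  ext n
  rw [coeff_expand]
  split_ifs with h
  · obtain ⟨m, rfl⟩ := h
    rw [Nat.mul_div_cancel_left _ (Nat.pos_of_ne_zero hd), coeff_theta, coeff_theta]
    simp [hd]
  · exact coeff_theta_eq_zero fun v hv ↦ h ⟨_, hv.symm⟩

theorem theta_add_one (Q : ι → ℕ) : theta (fun v ↦ Q v + 1) = X * theta Q := by
  ext n
  cases n with
  | zero => simp [coeff_theta]
  | succ n => simp [coeff_theta, coeff_succ_X_mul]

theorem expand_three (f : (ZMod 3)⟦X⟧) : expand 3 three_ne_zero f = f ^ 3 := by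
  have h := MvPowerSeries.map_frobenius_expand 3 three_ne_zero (f := f)
  rw [ZMod.frobenius_zmod] at h
  rw [← h]
  exact (MvPowerSeries.map_id (σ := Unit) (R := ZMod 3) ▸ rfl)

theorem three_eq_zero : (3 : (ZMod 3)⟦X⟧) = 0 := by
  have := map_natCast (C (R := ZMod 3)) 3
  rw [show ((3 : ℕ) : ZMod 3) = 0 from rfl, map_zero] at this
  exact_mod_cast this.symm

/-- The triangular number `u (u + 1) / 2` of an integer `u`. -/
def tri (u : ℤ) : ℕ := (u * (u + 1) / 2).toNat

theorem two_mul_tri (u : ℤ) : 2 * (tri u : ℤ) = u * (u + 1) := by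
  have h : 0 ≤ u * (u + 1) := by
    rcases le_or_gt 0 u with h | h
    · positivity
    · nlinarith
  have h2 := Int.mul_ediv_cancel' (Int.even_mul_succ_self u).two_dvd
  rw [tri, Int.toNat_of_nonneg (by omega), h2]

theorem tri_eq_iff {u : ℤ} {n : ℕ} : tri u = n ↔ u * (u + 1) = 2 * n := by
  rw [← two_mul_tri]
  omega

/-- `∑ X ^ x ^ 2` over all integers `x`. -/
noncomputable def squareTheta : (ZMod 3)⟦X⟧ := theta fun x : ℤ ↦ x.natAbs ^ 2

/-- `∑ X ^ (u (u + 1) / 2)` over all integers `u`. -/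
noncomputable def triTheta : (ZMod 3)⟦X⟧ := theta tri

theorem finite_fiber_sq (n : ℕ) : Finite {x : ℤ // x.natAbs ^ 2 = n} := by
  refine Set.Finite.subset (Set.finite_Icc (-n : ℤ) n) fun x (hx : x.natAbs ^ 2 = n) ↦ ?_
  have : x.natAbs ≤ n := hx ▸ Nat.le_self_pow two_ne_zero _
  simp only [Set.mem_Icc]
  omega

theorem finite_fiber_tri (n : ℕ) : Finite {u : ℤ // tri u = n} := by
  refine Set.Finite.subset (Set.finite_Icc (-(2 * n + 1) : ℤ) (2 * n)) fun u hu ↦ ?_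
  have : u * (u + 1) = 2 * n := tri_eq_iff.mp hu
  constructor <;> nlinarith

theorem squareTheta_sq : squareTheta ^ 2 = expand 2 two_ne_zero squareTheta ^ 2 +
    X * expand 2 two_ne_zero (expand 2 two_ne_zero triTheta) ^ 2 := by
  have hbij : Function.Bijective (Sum.elim (fun p : ℤ × ℤ ↦ (p.1 + p.2, p.1 - p.2))
      (fun p : ℤ × ℤ ↦ (p.1 + p.2 + 1, p.1 - p.2))) := by
    constructor
    · rintro (⟨a, b⟩ | ⟨a, b⟩) (⟨c, d⟩ | ⟨c, d⟩) h <;>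
        simp only [Sum.elim_inl, Sum.elim_inr, Prod.mk.injEq, Sum.inl.injEq, Sum.inr.injEq,
          reduceCtorEq] at h ⊢ <;> omega
    · rintro ⟨a, b⟩
      rcases Int.emod_two_eq_zero_or_one (a + b) with h | h
      · exact ⟨.inl ((a + b) / 2, (a - b) / 2), by
          simp only [Sum.elim_inl, Prod.mk.injEq]; omega⟩
      · exact ⟨.inr ((a + b - 1) / 2, (a - b - 1) / 2), by
          simp only [Sum.elim_inr, Prod.mk.injEq]; omega⟩
  have fin2 (n : ℕ) : Finite {x : ℤ // 2 * x.natAbs ^ 2 = n} :=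
    Set.Finite.subset (finite_fiber_sq (n / 2)) fun x (hx : _ = _) ↦ by
      show _ = _
      omega
  have fin4 (n : ℕ) : Finite {x : ℤ // 2 * (2 * tri x) = n} :=
    Set.Finite.subset (finite_fiber_tri (n / 4)) fun x (hx : _ = _) ↦ by
      show _ = _
      omega
  rw [sq, sq, sq, squareTheta, triTheta, ← theta_mul_left, ← theta_mul_left, ← theta_mul_left,
    ← theta_add finite_fiber_sq finite_fiber_sq, ← theta_add fin2 fin2, ← theta_add fin4 fin4,
    ← theta_add_one,
    theta_eq_add_of_bijective (finite_fiber_add finite_fiber_sq finite_fiber_sq) _ _ hbij]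
  congr 2 <;> funext ⟨a, b⟩ <;> zify <;> simp only [sq_abs]
  · ring
  · linear_combination -2 * two_mul_tri a - 2 * two_mul_tri b

theorem triTheta_sq :
    triTheta ^ 2 = 2 * squareTheta * expand 2 two_ne_zero triTheta := by
  have hbij : Function.Bijective (Sum.elim (fun p : ℤ × ℤ ↦ (p.2 + p.1, p.2 - p.1))
      (fun p : ℤ × ℤ ↦ (p.2 + p.1, p.1 - p.2 - 1))) := by
    constructor
    · rintro (⟨a, b⟩ | ⟨a, b⟩) (⟨c, d⟩ | ⟨c, d⟩) h <;>
        simp only [Sum.elim_inl, Sum.elim_inr, Prod.mk.injEq, Sum.inl.injEq, Sum.inr.injEq,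
          reduceCtorEq] at h ⊢ <;> omega
    · rintro ⟨a, b⟩
      rcases Int.emod_two_eq_zero_or_one (a + b) with h | h
      · exact ⟨.inl ((a - b) / 2, (a + b) / 2), by
          simp only [Sum.elim_inl, Prod.mk.injEq]; omega⟩
      · exact ⟨.inr ((a + b + 1) / 2, (a - b - 1) / 2), by
          simp only [Sum.elim_inr, Prod.mk.injEq]; omega⟩
  have fin2 (n : ℕ) : Finite {x : ℤ // 2 * tri x = n} :=
    Set.Finite.subset (finite_fiber_tri (n / 2)) fun x (hx : _ = _) ↦ by
      show _ = _
      omega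
  rw [mul_assoc, two_mul, sq, squareTheta, triTheta, ← theta_mul_left,
    ← theta_add finite_fiber_tri finite_fiber_tri, ← theta_add finite_fiber_sq fin2,
    theta_eq_add_of_bijective (finite_fiber_add finite_fiber_tri finite_fiber_tri) _ _ hbij]
  congr 2 <;> funext ⟨a, b⟩ <;> zify <;> simp only [sq_abs] <;>
    refine mul_left_cancel₀ two_ne_zero ?_
  · linear_combination two_mul_tri (b + a) + two_mul_tri (b - a) - 2 * two_mul_tri b
  · linear_combination two_mul_tri (b + a) + two_mul_tri (a - b - 1) - 2 * two_mul_tri b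

theorem eq_one_of_expand_eq {f : (ZMod 3)⟦X⟧} {d : ℕ} (hd : d ≠ 0) (hd' : d ≠ 1)
    (h : expand d hd f = f) (h0 : coeff 0 f = 1) : f = 1 := by
  ext n
  induction n using Nat.strong_induction_on with
  | _ n ih =>
    rcases eq_or_ne n 0 with rfl | hn
    · simpa using h0
    · rw [← h, coeff_expand]
      split_ifs with hdvd
      · rw [ih _ (Nat.div_lt_self (by omega) (by omega)), coeff_one, coeff_one,
          if_neg hn, if_neg]
        exact fun h' ↦ hn (Nat.eq_zero_of_dvd_of_div_eq_zero hdvd h')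
      · rw [coeff_one, if_neg hn]

theorem coeff_zero_squareTheta : coeff 0 squareTheta = 1 := by
  have : Nat.card {x : ℤ // x.natAbs ^ 2 = 0} = 1 := by simp
  rw [squareTheta, coeff_theta, this, Nat.cast_one]

theorem squareTheta_pow_four_add :
    squareTheta ^ 4 + X * expand 2 two_ne_zero triTheta ^ 4 = 1 := by
  refine eq_one_of_expand_eq two_ne_zero (by norm_num) ?_ ?_
  · have h1 := squareTheta_sq
    have h2 := congrArg (expand 2 two_ne_zero) triTheta_sq
    simp only [map_add, map_mul, map_pow, map_ofNat, expand_X] at h2 ⊢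
    generalize expand 2 two_ne_zero (expand 2 two_ne_zero triTheta) = w at *
    generalize expand 2 two_ne_zero triTheta = v at *
    generalize expand 2 two_ne_zero squareTheta = r at *
    linear_combination (-(squareTheta ^ 2) - (r ^ 2 + X * w ^ 2)) * h1 -
      X * (v ^ 2 + 2 * r * w) * h2 - 2 * X * r ^ 2 * w ^ 2 * three_eq_zero
  · have h := coeff_zero_squareTheta
    rw [coeff_zero_eq_constantCoeff_apply] at h
    simp [h]

theorem X_mul_triTheta_pow_eight :
    X * triTheta ^ 8 = squareTheta ^ 4 * (1 - squareTheta ^ 4) := by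
  have h1 := squareTheta_pow_four_add
  rw [← h1, show triTheta ^ 8 = (triTheta ^ 2) ^ 4 by ring, triTheta_sq]
  generalize expand 2 two_ne_zero triTheta = v at *
  linear_combination 5 * X * v ^ 4 * squareTheta ^ 4 * three_eq_zero

/-- All exponents occurring in `f` are congruent to `r` modulo 3. -/
def SupportedMod (r : ZMod 3) (f : (ZMod 3)⟦X⟧) : Prop :=
  ∀ n : ℕ, (n : ZMod 3) ≠ r → coeff n f = 0

theorem SupportedMod.mul {r s : ZMod 3} {f g : (ZMod 3)⟦X⟧} (hf : SupportedMod r f)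
    (hg : SupportedMod s g) : SupportedMod (r + s) (f * g) := by
  intro n hn
  rw [coeff_mul]
  refine sum_eq_zero fun p hp ↦ ?_
  rw [HasAntidiagonal.mem_antidiagonal] at hp
  by_cases h1 : (p.1 : ZMod 3) = r
  · rw [hg p.2 fun h2 ↦ hn (by rw [← hp, Nat.cast_add, h1, h2]), mul_zero]
  · rw [hf p.1 h1, zero_mul]

theorem SupportedMod.add {r : ZMod 3} {f g : (ZMod 3)⟦X⟧} (hf : SupportedMod r f)
    (hg : SupportedMod r g) : SupportedMod r (f + g) := fun n hn ↦ by
  rw [map_add, hf n hn, hg n hn, add_zero]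

theorem supportedMod_cube (f : (ZMod 3)⟦X⟧) : SupportedMod 0 (f ^ 3) := fun n hn ↦ by
  rw [← expand_three, coeff_expand_of_not_dvd]
  rwa [← ZMod.natCast_eq_zero_iff]

theorem supportedMod_X : SupportedMod 1 X := fun n hn ↦ by
  rw [coeff_X, if_neg]
  rintro rfl
  simp at hn

theorem coeff_cube (f : (ZMod 3)⟦X⟧) (n : ℕ) : coeff (3 * n) (f ^ 3) = coeff n f := by
  rw [← expand_three, coeff_expand_mul]

theorem supportedMod_squareTheta_sub : SupportedMod 1 (squareTheta - squareTheta ^ 9) := by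
  have hbij : Function.Bijective
      (Sum.elim (fun x : ℤ ↦ 3 * x) (Subtype.val : {x : ℤ // ¬ 3 ∣ x} → ℤ)) := by
    constructor
    · rintro (a | a) (b | b) h <;>
        simp only [Sum.elim_inl, Sum.elim_inr, Sum.inl.injEq, Sum.inr.injEq, reduceCtorEq] at h ⊢
      · omega
      · exact b.2 ⟨_, h.symm⟩
      · exact a.2 ⟨_, h⟩
      · exact Subtype.ext h
    · intro a
      by_cases h : 3 ∣ a
      · obtain ⟨b, rfl⟩ := h
        exact ⟨.inl b, rfl⟩
      · exact ⟨.inr ⟨a, h⟩, rfl⟩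
  have h := theta_eq_add_of_bijective finite_fiber_sq _ _ hbij
  have h9 : theta (fun x : ℤ ↦ (3 * x).natAbs ^ 2) = squareTheta ^ 9 := by
    rw [show squareTheta ^ 9 = (squareTheta ^ 3) ^ 3 by ring, ← expand_three, ← expand_three,
      squareTheta, ← theta_mul_left, ← theta_mul_left]
    congr 1
    funext x
    rw [Int.natAbs_mul]
    simp only [Int.reduceAbs]
    ring
  rw [h9, ← squareTheta] at h
  rw [sub_eq_iff_eq_add'.mpr h]
  intro n hn
  refine coeff_theta_eq_zero fun x hx ↦ hn ?_
  rw [← hx, Nat.cast_pow]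
  have : (x.1.natAbs : ZMod 3) ≠ 0 := by
    rw [Ne, ZMod.natCast_eq_zero_iff]
    have := x.2
    omega
  revert this
  generalize (x.1.natAbs : ZMod 3) = y
  revert y
  decide

theorem supportedMod_triTheta_sub : SupportedMod 0 (triTheta - X * triTheta ^ 9) := by
  have hbij : Function.Bijective
      (Sum.elim (fun x : ℤ ↦ 3 * x + 1) (Subtype.val : {x : ℤ // x % 3 ≠ 1} → ℤ)) := by
    constructor
    · rintro (a | a) (b | b) h <;>
        simp only [Sum.elim_inl, Sum.elim_inr, Sum.inl.injEq, Sum.inr.injEq, reduceCtorEq] at h ⊢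
      · omega
      · have := b.2
        omega
      · have := a.2
        omega
      · exact Subtype.ext h
    · intro a
      by_cases h : a % 3 = 1
      · exact ⟨.inl (a / 3), by simp only [Sum.elim_inl]; omega⟩
      · exact ⟨.inr ⟨a, h⟩, rfl⟩
  have h := theta_eq_add_of_bijective finite_fiber_tri _ _ hbij
  have h9 : theta (fun x : ℤ ↦ tri (3 * x + 1)) = X * triTheta ^ 9 := by
    rw [show triTheta ^ 9 = (triTheta ^ 3) ^ 3 by ring, ← expand_three, ← expand_three,
      triTheta, ← theta_mul_left, ← theta_mul_left, ← theta_add_one]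
    congr 1
    funext x
    rw [tri_eq_iff]
    push_cast
    linear_combination -9 * two_mul_tri x
  rw [h9, ← triTheta] at h
  rw [sub_eq_iff_eq_add'.mpr h]
  intro n hn
  refine coeff_theta_eq_zero fun x hx ↦ hn ?_
  rw [← hx, ZMod.natCast_eq_zero_iff]
  have h2 := two_mul_tri x.1
  have h3 := x.2
  obtain ⟨k, hk⟩ : (3 : ℤ) ∣ x.1 * (x.1 + 1) := by
    rcases (by omega : x.1 % 3 = 0 ∨ x.1 % 3 = 2) with h | h
    · exact Dvd.dvd.mul_right (by omega) _
    · exact Dvd.dvd.mul_left (by omega) _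
  omega

end ThetaSeries

section GeneratingFunction

open scoped PowerSeries.WithPiTopology
open Filter Topology

theorem dvd_theta_sub_sum {Q : ℕ → ℕ} (hQ : ∀ s, s ≤ Q s) (n : ℕ) :
    X ^ n ∣ theta Q - ∑ s ∈ range n, X ^ Q s := by
  rw [X_pow_dvd_iff]
  intro m hm
  have : Nat.card {s // Q s = m} = #{s ∈ range n | m = Q s} :=
    Nat.subtype_card _ fun s ↦ by
      have := hQ s
      rw [mem_filter, mem_range]
      omega
  simp only [map_sub, map_sum, coeff_theta, coeff_X_pow, sum_boole, this, sub_self]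

theorem bijective_sumElim_natCast_neg_sub_one : Function.Bijective
    (Sum.elim (fun s : ℕ ↦ (s : ℤ)) (fun s : ℕ ↦ -(s : ℤ) - 1)) := by
  constructor
  · rintro (a | a) (b | b) h <;>
      simp only [Sum.elim_inl, Sum.elim_inr, Sum.inl.injEq, Sum.inr.injEq, reduceCtorEq] at h ⊢ <;>
      omega
  · intro a
    rcases le_or_gt 0 a with h | h
    · exact ⟨.inl a.toNat, by simp only [Sum.elim_inl]; omega⟩
    · exact ⟨.inr (-a - 1).toNat, by simp only [Sum.elim_inr]; omega⟩

theorem triTheta_eq : triTheta = 2 * theta fun s : ℕ ↦ s * (s + 1) / 2 := by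
  rw [triTheta, theta_eq_add_of_bijective finite_fiber_tri _ _
    bijective_sumElim_natCast_neg_sub_one, two_mul]
  have key (s : ℕ) : 2 * (s * (s + 1) / 2) = s * (s + 1) :=
    Nat.mul_div_cancel' (Nat.even_mul_succ_self s).two_dvd
  congr 2
  all_goals
    funext s
    rw [tri_eq_iff]
    have := key s
    zify at this
    push_cast
    linear_combination -this

theorem squareTheta_eq : squareTheta = 1 + 2 * theta fun s : ℕ ↦ (s + 1) ^ 2 := by
  have hbij : Function.Bijective (Sum.elim (fun _ : Unit ↦ 0) (fun s : ℕ ↦ s + 1)) := by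
    constructor
    · rintro (a | a) (b | b) h
      · rfl
      · simp at h
      · simp at h
      · simpa using h
    · rintro (_ | a)
      · exact ⟨.inl (), rfl⟩
      · exact ⟨.inr a, rfl⟩
  have hfin (n : ℕ) : Finite {s : ℕ // s ^ 2 = n} :=
    Set.Finite.subset (Set.finite_Iic n) fun s (hs : s ^ 2 = n) ↦
      hs ▸ Nat.le_self_pow two_ne_zero _
  have h1 : theta (fun _ : Unit ↦ 0 ^ 2) = 1 := by
    ext n
    rcases eq_or_ne n 0 with rfl | hn
    · simp [coeff_theta]
    · rw [coeff_theta_eq_zero (by simpa using hn.symm), coeff_one, if_neg hn]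
  have h2 (s : ℕ) : (-(s : ℤ) - 1).natAbs = s + 1 := by omega
  rw [squareTheta, theta_eq_add_of_bijective finite_fiber_sq _ _
    bijective_sumElim_natCast_neg_sub_one]
  simp only [Int.natAbs_natCast, h2]
  rw [theta_eq_add_of_bijective hfin _ _ hbij, h1]
  ring

theorem dvd_evalNegHom {n : ℕ} {f : (ZMod 3)⟦X⟧} (h : X ^ n ∣ f) : X ^ n ∣ evalNegHom f := by
  have := map_dvd evalNegHom h
  rw [map_pow, evalNegHom_X, neg_pow] at this
  exact dvd_of_mul_left_dvd this

theorem evalNegHom_evalNegHom (f : (ZMod 3)⟦X⟧) : evalNegHom (evalNegHom f) = f := by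
  ext n
  simp [evalNegHom, coeff_rescale, ← mul_assoc, ← mul_pow]

theorem tendsto_of_X_pow_dvd_sub {R : Type*} [CommRing R] [TopologicalSpace R] {f : ℕ → R⟦X⟧}
    {g : R⟦X⟧} (h : ∀ n, X ^ n ∣ f n - g) : Tendsto f atTop (𝓝 g) := by
  rw [WithPiTopology.tendsto_iff_coeff_tendsto]
  refine fun d ↦ tendsto_atTop_of_eventually_const (i₀ := d + 1) fun n hn ↦ ?_
  have := X_pow_dvd_iff.mp (h n) d (by omega)
  rwa [map_sub, sub_eq_zero] at this

theorem dvd_prod_sub_squareTheta (n : ℕ) :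
    X ^ n ∣ ∏ k ∈ range n, (1 - X ^ (k + 1)) * (1 + X ^ (k + 1))⁻¹ - evalNegHom squareTheta := by
  have h := sum_alternating_square X (fun k ↦ ((1 + X ^ k)⁻¹ : (ZMod 3)⟦X⟧)) (fun k ↦ by
    refine PowerSeries.mul_inv_cancel _ ?_
    rcases k with _ | k
    · simp only [pow_zero, map_add, map_one]
      decide
    · simp) n
  have h0 : 2 * (1 + X ^ 0 : (ZMod 3)⟦X⟧)⁻¹ = 1 := by
    rw [pow_zero, one_add_one_eq_two]
    refine PowerSeries.mul_inv_cancel _ ?_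
    rw [map_ofNat]
    decide
  have hd := dvd_evalNegHom (dvd_theta_sub_sum (Q := fun s ↦ (s + 1) ^ 2)
    (fun s ↦ by nlinarith) n)
  have hs : evalNegHom (∑ s ∈ range n, X ^ ((s + 1) ^ 2) : (ZMod 3)⟦X⟧) =
      ∑ s ∈ range n, (-1) ^ (s + 1) * X ^ ((s + 1) ^ 2) := by
    rw [map_sum]
    refine sum_congr rfl fun s _ ↦ ?_
    rw [map_pow, evalNegHom_X, neg_pow]
    congr 1
    rcases Nat.even_or_odd (s + 1) with h | h
    · rw [h.neg_one_pow, (h.pow_of_ne_zero two_ne_zero).neg_one_pow]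
    · rw [h.neg_one_pow, h.pow.neg_one_pow]
  rw [map_sub, hs] at hd
  rw [sum_range_succ', ← range_eq_Ico] at h
  simp only [pow_zero, zero_mul, one_mul, mul_one] at h h0
  rw [h0, mul_one] at h
  have hd' : X ^ n ∣ ∑ s ∈ range n, (-1) ^ (s + 1) *
      (∏ k ∈ Ico (s + 1) n, (1 - X ^ (k + 1)) * (1 + X ^ (k + 1) : (ZMod 3)⟦X⟧)⁻¹) *
      X ^ ((s + 1) * (n + 1)) * (2 * (1 + X ^ (s + 1))⁻¹) :=
    dvd_sum fun s _ ↦ ((pow_dvd_pow X (by nlinarith)).mul_left _).mul_right _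
  rw [squareTheta_eq, map_add, map_mul, map_one, map_ofNat]
  rw [← eq_sub_iff_add_eq'] at h
  rw [h]
  convert (hd'.neg_right).sub (hd.mul_left 2) using 1
  ring

theorem dvd_prod_sub_triTheta (n : ℕ) :
    X ^ n ∣ ∏ k ∈ range n, (1 - X ^ (2 * k + 2)) * (1 + X ^ (2 * k + 1))⁻¹ -
      evalNegHom (2 * triTheta) := by
  have h4 : 2 * triTheta = theta fun s : ℕ ↦ s * (s + 1) / 2 := by
    rw [triTheta_eq]
    linear_combination (theta fun s : ℕ ↦ s * (s + 1) / 2) * three_eq_zero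
  have h := sum_triangular (-X) (fun k ↦ ((1 + X ^ (2 * k + 1))⁻¹ : (ZMod 3)⟦X⟧)) (fun k ↦ by
    rw [Odd.neg_pow ⟨k, rfl⟩, sub_neg_eq_add]
    refine PowerSeries.mul_inv_cancel _ ?_
    simp) n
  have he (k : ℕ) : (-X : (ZMod 3)⟦X⟧) ^ (2 * k + 2) = X ^ (2 * k + 2) :=
    Even.neg_pow ⟨k + 1, by ring⟩ _
  simp only [he] at h
  have hd := dvd_evalNegHom (dvd_theta_sub_sum (Q := fun s ↦ s * (s + 1) / 2)
    (fun s ↦ by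
      rw [Nat.le_div_iff_mul_le two_pos]
      rcases s with _ | s
      · simp
      · nlinarith) (2 * n + 1))
  simp only [map_sub, map_sum, map_pow, evalNegHom_X, ← h4] at hd
  rw [← h, sum_range_succ', ← range_eq_Ico, zero_mul, pow_zero, mul_one] at hd
  have hd' : X ^ n ∣ ∑ s ∈ range n,
      (∏ k ∈ Ico (s + 1) n, (1 - X ^ (2 * k + 2)) * (1 + X ^ (2 * k + 1) : (ZMod 3)⟦X⟧)⁻¹) *
      (-X) ^ ((s + 1) * (2 * n + 1)) :=
    dvd_sum fun s _ ↦ by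
      rw [neg_pow]
      exact ((pow_dvd_pow X (by nlinarith)).mul_left _).mul_left _
  have hd'' := ((pow_dvd_pow X (show n ≤ 2 * n + 1 by omega)).trans hd).add hd'
  rw [← dvd_neg] at hd''
  convert hd'' using 1
  ring

theorem prod_mul_prod (n : ℕ) :
    (∏ k ∈ range n, (1 - X ^ (2 * k + 1) : (ZMod 3)⟦X⟧)⁻¹ * (1 + X ^ (2 * k + 2))) *
      ∏ k ∈ range (2 * n), (1 - X ^ (k + 1)) * (1 + X ^ (k + 1))⁻¹ =
    ∏ k ∈ range n, (1 - X ^ (2 * k + 2)) * (1 + X ^ (2 * k + 1))⁻¹ := by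
  induction n with
  | zero => simp
  | succ n ih =>
    rw [mul_add_one, prod_range_succ, prod_range_succ _ (2 * n + 1), prod_range_succ _ (2 * n),
      prod_range_succ, ← ih, show 2 * n + 1 + 1 = 2 * n + 2 by ring]
    have h1 : (1 - X ^ (2 * n + 1) : (ZMod 3)⟦X⟧) * (1 - X ^ (2 * n + 1))⁻¹ = 1 :=
      PowerSeries.mul_inv_cancel _ (by simp)
    have h2 : (1 + X ^ (2 * n + 2) : (ZMod 3)⟦X⟧) * (1 + X ^ (2 * n + 2))⁻¹ = 1 :=
      PowerSeries.mul_inv_cancel _ (by simp)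
    generalize (1 - X ^ (2 * n + 1) : (ZMod 3)⟦X⟧)⁻¹ = a at *
    generalize (1 + X ^ (2 * n + 2) : (ZMod 3)⟦X⟧)⁻¹ = b at *
    generalize (∏ k ∈ range n, (1 - X ^ (2 * k + 1) : (ZMod 3)⟦X⟧)⁻¹ * (1 + X ^ (2 * k + 2))) = A
    generalize (1 + X ^ (2 * n + 1) : (ZMod 3)⟦X⟧)⁻¹ = c
    generalize (∏ k ∈ range (2 * n), (1 - X ^ (k + 1)) * (1 + X ^ (k + 1) : (ZMod 3)⟦X⟧)⁻¹) = B
    linear_combination A * B * c * (1 - X ^ (2 * n + 2)) *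
      ((1 + X ^ (2 * n + 2)) * b * h1 + h2)

/-- The generating function of `ped` modulo 3. -/
noncomputable def pedSeries : (ZMod 3)⟦X⟧ := PowerSeries.mk fun n ↦ (ped n : ZMod 3)

theorem pedSeries_eq_genFun :
    pedSeries = Nat.Partition.genFun fun i c ↦ if Even i → c ≤ 1 then 1 else 0 := by
  classical
  ext n
  rw [Nat.Partition.coeff_genFun, pedSeries, coeff_mk, ped, Nat.card_eq_fintype_card,
    Fintype.card_subtype, ← sum_boole]
  refine sum_congr rfl fun p _ ↦ ?_
  rw [Finsupp.prod, prod_boole]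
  refine if_congr ⟨fun h i _ hi ↦ by simpa using h i hi, fun h i hi ↦ ?_⟩ rfl rfl
  by_cases hp : i ∈ p.parts
  · simpa using h i (by simpa using hp) hi
  · simp [Multiset.count_eq_zero_of_notMem hp]

theorem tendsto_pedSeries [TopologicalSpace (ZMod 3)] [DiscreteTopology (ZMod 3)] :
    Tendsto (fun n ↦ ∏ k ∈ range n, (1 - X ^ (2 * k + 1) : (ZMod 3)⟦X⟧)⁻¹ * (1 + X ^ (2 * k + 2)))
      atTop (𝓝 pedSeries) := by
  have h := (Nat.Partition.hasProd_genFun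
    fun i c ↦ (if Even i → c ≤ 1 then 1 else 0 : ZMod 3)).tendsto_prod_nat
  rw [← pedSeries_eq_genFun] at h
  have h2 := h.comp (tendsto_id.const_mul_atTop' (zero_lt_two' ℕ))
  refine h2.congr fun n ↦ ?_
  simp only [Function.comp_apply, id]
  induction n with
  | zero => simp
  | succ n ih =>
    rw [show 2 * (n + 1) = 2 * n + 1 + 1 by ring, prod_range_succ, prod_range_succ, ih,
      prod_range_succ, mul_assoc]
    congr 2
    · have hodd : ¬ Even (2 * n + 1) := by simp
      simp only [hodd, false_imp_iff, if_true, one_smul]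
      have h0 : constantCoeff (X ^ (2 * n + 1) : (ZMod 3)⟦X⟧) = 0 := by simp
      have hsum := WithPiTopology.summable_pow_of_constantCoeff_eq_zero h0
      have hgeom := WithPiTopology.tsum_pow_mul_one_sub_of_constantCoeff_eq_zero h0
      rw [tsum_eq_zero_add' (by simpa only [pow_succ] using hsum.mul_right _), pow_zero] at hgeom
      simp only [← pow_mul] at hgeom
      rwa [PowerSeries.eq_inv_iff_mul_eq_one (by simp)]
    · have heven : Even (2 * n + 1 + 1) := ⟨n + 1, by ring⟩
      rw [tsum_eq_single 0 fun j hj ↦ by simp [heven, hj]]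
      simp

theorem pedSeries_mul : pedSeries * evalNegHom squareTheta = evalNegHom (2 * triTheta) := by
  let _ : TopologicalSpace (ZMod 3) := ⊥
  have : DiscreteTopology (ZMod 3) := ⟨rfl⟩
  have h1 := tendsto_of_X_pow_dvd_sub dvd_prod_sub_squareTheta
  have h2 := tendsto_of_X_pow_dvd_sub dvd_prod_sub_triTheta
  have h3 := tendsto_pedSeries.mul (h1.comp (tendsto_id.const_mul_atTop' (zero_lt_two' ℕ)))
  exact tendsto_nhds_unique h3 (h2.congr fun n ↦ (prod_mul_prod n).symm)

theorem evalNegHom_pedSeries_mul : evalNegHom pedSeries * squareTheta = 2 * triTheta := by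
  have := congrArg evalNegHom pedSeries_mul
  rwa [map_mul, evalNegHom_evalNegHom, evalNegHom_evalNegHom] at this

end GeneratingFunction

section Congruence

theorem eq_of_mul_eq_two_mul {R : Type*} [CommRing R] {E f w u x : R} (h3 : (3 : R) = 0)
    (hE : E * f = 2 * w) (hinv : f * u = 1) (h8 : x * w ^ 8 = f ^ 4 * (1 - f ^ 4)) :
    E = f ^ 3 * (x * w ^ 9) +
      (2 * (u ^ 3 * ((w - x * w ^ 9) * (f ^ 9 * f ^ 9) +
        x * w ^ 9 * ((f - f ^ 9) * (f - f ^ 9)))) +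
      2 * (u ^ 3 * ((w - x * w ^ 9) * ((f - f ^ 9) * (f - f ^ 9)) +
        2 * (f ^ 9 * (f - f ^ 9) * (x * w ^ 9))))) := by
  have hE' : E = 2 * w * f ^ 2 * u ^ 3 := by
    linear_combination f ^ 2 * u ^ 3 * hE - E * (f ^ 2 * u ^ 2 + f * u + 1) * hinv
  have hu : u ^ 3 * f ^ 9 = f ^ 6 := by
    linear_combination f ^ 6 * (f ^ 2 * u ^ 2 + f * u + 1) * hinv
  have hY : x * w ^ 9 = f ^ 4 * (1 - f ^ 4) * w := by linear_combination w * h8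
  rw [hE', hY]
  linear_combination
    2 * (2 * (w - f ^ 4 * (1 - f ^ 4) * w) * (f - f ^ 9) +
      f ^ 4 * (1 - f ^ 4) * w * f ^ 9) * hu +
    f ^ 7 * w * (1 - f ^ 4) * (1 + 2 * f ^ 12) * h3

theorem supportedMod_pow_nine (f : (ZMod 3)⟦X⟧) : SupportedMod 0 (f ^ 9) := by
  rw [show f ^ 9 = (f ^ 3) ^ 3 by ring]
  exact supportedMod_cube _

theorem SupportedMod.two_mul {r : ZMod 3} {f : (ZMod 3)⟦X⟧} (hf : SupportedMod r f) :
    SupportedMod r (2 * f) := by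
  rw [_root_.two_mul]
  exact hf.add hf

/-- The part of `evalNegHom pedSeries` supported on exponents congruent to 1 modulo 3. -/
theorem coeff_evalNegHom_pedSeries {n : ℕ} (hn : (n : ZMod 3) = 1) :
    coeff n (evalNegHom pedSeries) = coeff n (squareTheta ^ 3 * (X * triTheta ^ 9)) := by
  have hinv : squareTheta * squareTheta⁻¹ = 1 := PowerSeries.mul_inv_cancel _ (by
    rw [← coeff_zero_eq_constantCoeff_apply, coeff_zero_squareTheta]
    exact one_ne_zero)
  have hb := supportedMod_squareTheta_sub
  have hc := supportedMod_triTheta_sub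
  have hu := supportedMod_cube squareTheta⁻¹
  have hA := supportedMod_pow_nine squareTheta
  have hY := supportedMod_X.mul (supportedMod_pow_nine triTheta)
  have h0 := (hu.mul ((hc.mul (hA.mul hA)).add (hY.mul (hb.mul hb)))).two_mul
  have h2 := (hu.mul ((hc.mul (hb.mul hb)).add ((hA.mul hb).mul hY).two_mul)).two_mul
  rw [eq_of_mul_eq_two_mul three_eq_zero evalNegHom_pedSeries_mul hinv X_mul_triTheta_pow_eight,
    map_add, map_add, h0 n (by rw [hn]; decide), h2 n (by rw [hn]; decide), add_zero, add_zero]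

theorem coeff_three_mul_add_one_evalNegHom_pedSeries (k : ℕ) :
    coeff (3 * k + 1) (evalNegHom pedSeries) = coeff k (squareTheta * triTheta ^ 3) := by
  rw [coeff_evalNegHom_pedSeries (by simp [show (3 : ZMod 3) = 0 from rfl]),
    show squareTheta ^ 3 * (X * triTheta ^ 9) = X * (squareTheta * triTheta ^ 3) ^ 3 by ring,
    coeff_succ_X_mul, coeff_cube]

theorem coeff_squareTheta_mul_cube {k : ℕ} (f : (ZMod 3)⟦X⟧) (hk : (k : ZMod 3) ≠ 1) :
    coeff k (squareTheta * f ^ 3) = coeff k ((squareTheta ^ 3 * f) ^ 3) := by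
  rw [show squareTheta * f ^ 3 =
    (squareTheta ^ 3 * f) ^ 3 + (squareTheta - squareTheta ^ 9) * f ^ 3 by ring, map_add,
    (supportedMod_squareTheta_sub.mul (supportedMod_cube f)) k (by rwa [add_zero]), add_zero]

theorem coeff_nine_mul_add_seven_evalNegHom_pedSeries (m : ℕ) :
    coeff (9 * m + 7) (evalNegHom pedSeries) = 0 := by
  have h : ((3 * m + 2 : ℕ) : ZMod 3) = 2 := by simp [show (3 : ZMod 3) = 0 from rfl]
  rw [show 9 * m + 7 = 3 * (3 * m + 2) + 1 by ring, coeff_three_mul_add_one_evalNegHom_pedSeries,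
    coeff_squareTheta_mul_cube _ (by rw [h]; decide)]
  exact supportedMod_cube _ _ (by rw [h]; decide)

theorem coeff_nine_mul_add_one_evalNegHom_pedSeries {m : ℕ} (hm : (m : ZMod 3) = 1) :
    coeff (9 * m + 1) (evalNegHom pedSeries) = coeff m (evalNegHom pedSeries) := by
  rw [show 9 * m + 1 = 3 * (3 * m) + 1 by ring, coeff_three_mul_add_one_evalNegHom_pedSeries,
    coeff_squareTheta_mul_cube _ (by simp [show (3 : ZMod 3) = 0 from rfl]), coeff_cube,
    coeff_evalNegHom_pedSeries hm, show squareTheta ^ 3 * triTheta =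
      squareTheta ^ 3 * (X * triTheta ^ 9) +
        squareTheta ^ 3 * (triTheta - X * triTheta ^ 9) by ring, map_add,
    ((supportedMod_cube squareTheta).mul supportedMod_triTheta_sub) m (by rw [hm]; decide),
    add_zero]

theorem ped_modEq_zero_iff (n : ℕ) :
    ped n ≡ 0 [MOD 3] ↔ coeff n (evalNegHom pedSeries) = 0 := by
  rw [evalNegHom, coeff_rescale, pedSeries, coeff_mk, mul_eq_zero_iff_left
    (pow_ne_zero _ (by decide)), Nat.modEq_zero_iff_dvd, ZMod.natCast_eq_zero_iff]

end Congruence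

end Ped

theorem ped_cong_19 (n α : ℕ) :
    ped (3 ^ (2 * α + 2) * n + (19 * 3 ^ (2 * α + 1) - 1) / 8) ≡ 0 [MOD 3] := by
  have hmod (α : ℕ) : ∃ k, 19 * 3 ^ (2 * α + 1) = 8 * (3 * k + 1) + 1 := by
    induction α with
    | zero => exact ⟨2, by norm_num⟩
    | succ α ih =>
      obtain ⟨k, hk⟩ := ih
      refine ⟨9 * k + 3, ?_⟩
      rw [show 2 * (α + 1) + 1 = 2 * α + 1 + 2 by ring, pow_add]
      omega
  rw [Ped.ped_modEq_zero_iff]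
  induction α with
  | zero => exact Ped.coeff_nine_mul_add_seven_evalNegHom_pedSeries n
  | succ α ih =>
    obtain ⟨k, hk⟩ := hmod α
    have hdiv : (19 * 3 ^ (2 * α + 1) - 1) / 8 = 3 * k + 1 := by omega
    have hdiv' : (19 * 3 ^ (2 * (α + 1) + 1) - 1) / 8 = 9 * (3 * k + 1) + 1 := by
      rw [show 2 * (α + 1) + 1 = 2 * α + 1 + 2 by ring, pow_add]
      omega
    rw [hdiv] at ih
    rw [hdiv', show 3 ^ (2 * (α + 1) + 2) * n + (9 * (3 * k + 1) + 1) =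
      9 * (3 ^ (2 * α + 2) * n + (3 * k + 1)) + 1 by ring,
      Ped.coeff_nine_mul_add_one_evalNegHom_pedSeries, ih]
    rw [pow_succ]
    simp [show (3 : ZMod 3) = 0 from rfl]
end

section
/- For all integers n ≥ 0 and α ≥ 0, p̄(3^{2α}(27n+18)) ≡ 0 (mod 3). -/
/-- Number of overpartitions of `n`: pairs consisting of a partition of some
`m ≤ n` into distinct parts (the overlined parts) and a partition of `n - m`. -/
def pbar (n : ℕ) : ℕ :=
  ∑ m ∈ Finset.range (n + 1),
    (Nat.Partition.distincts m).card * Fintype.card (Nat.Partition (n - m))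

open PowerSeries

namespace Overpartition

section Theta

variable (R : Type*) [CommRing R]

/-- The power series `∑ (-1) ^ j * X ^ (j ^ 2)`, the sum being over all integers `j`. -/
noncomputable def altTheta : R⟦X⟧ :=
  PowerSeries.mk fun n ↦ if n = 0 then 1 else if IsSquare n then 2 * (-1) ^ n else 0

variable {R}

theorem isSquare_of_coeff_altTheta_ne_zero {n : ℕ} (h : coeff n (altTheta R) ≠ 0) :
    IsSquare n := by
  by_contra hn
  refine h ?_
  have h0 : n ≠ 0 := by
    rintro rfl
    exact hn ⟨0, rfl⟩
  simp [altTheta, hn, h0]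

theorem coeff_altTheta_nine_mul (n : ℕ) :
    coeff (9 * n) (altTheta R) = coeff n (altTheta R) := by
  have hsq : IsSquare (9 * n) ↔ IsSquare n := by
    constructor
    · rintro ⟨r, hr⟩
      have h3 : 3 ∣ r := by
        have : 3 ∣ r * r := ⟨3 * n, by linarith⟩
        exact (Nat.prime_three.dvd_mul.mp this).elim id id
      obtain ⟨s, rfl⟩ := h3
      exact ⟨s, by linarith⟩
    · rintro ⟨r, rfl⟩
      exact ⟨3 * r, by ring⟩
  have hpow : (-1 : R) ^ (9 * n) = (-1) ^ n := by
    rw [pow_mul]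
    norm_num [Odd.neg_one_pow (by decide : Odd 9)]
  simp [altTheta, hsq, hpow]

/-- The finite form of the Gauss identity `∑ (-1) ^ j q ^ (j ^ 2) = ∏ (1 - q ^ i) / (1 + q ^ i)`. -/
theorem prod_one_add_pow_mul_sum_neg_one_pow_mul_pow_sq (q : R) (n : ℕ) :
    (∏ i ∈ Finset.range n, (1 + q ^ (i + 1))) *
        (1 + 2 * ∑ j ∈ Finset.range n, (-1) ^ (j + 1) * q ^ ((j + 1) ^ 2)) =
      (∏ i ∈ Finset.range n, (1 - q ^ (i + 1))) +
        2 * ∑ t ∈ Finset.range n, (-1) ^ (t + 1) * q ^ ((t + 1) * (n + 1)) *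
          (∏ i ∈ Finset.range t, (1 + q ^ (i + 1))) *
          ∏ i ∈ Finset.Ico (t + 1) n, (1 - q ^ (i + 1)) := by
  induction n with
  | zero => simp
  | succ n ih =>
    have hstep : ∑ t ∈ Finset.range (n + 1), (-1) ^ (t + 1) * q ^ ((t + 1) * (n + 1 + 1)) *
          (∏ i ∈ Finset.range t, (1 + q ^ (i + 1))) *
          ∏ i ∈ Finset.Ico (t + 1) (n + 1), (1 - q ^ (i + 1)) =
        (1 + q ^ (n + 1)) * (∑ t ∈ Finset.range n, (-1) ^ (t + 1) * q ^ ((t + 1) * (n + 1)) *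
          (∏ i ∈ Finset.range t, (1 + q ^ (i + 1))) *
          ∏ i ∈ Finset.Ico (t + 1) n, (1 - q ^ (i + 1))) +
        q ^ (n + 1) * (∏ i ∈ Finset.range n, (1 - q ^ (i + 1))) +
        (-1) ^ (n + 1) * q ^ ((n + 1) ^ 2) * ∏ i ∈ Finset.range (n + 1), (1 + q ^ (i + 1)) := by
      set D : ℕ → R := fun t ↦ (-1) ^ (t + 1) * q ^ ((t + 1) * (n + 1)) *
        (∏ i ∈ Finset.range t, (1 + q ^ (i + 1))) *
        ∏ i ∈ Finset.Ico t n, (1 - q ^ (i + 1)) with hD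
      have htel := Finset.sum_range_sub D n
      have hterm : ∀ t ∈ Finset.range n, (-1) ^ (t + 1) * q ^ ((t + 1) * (n + 1 + 1)) *
          (∏ i ∈ Finset.range t, (1 + q ^ (i + 1))) *
          ∏ i ∈ Finset.Ico (t + 1) (n + 1), (1 - q ^ (i + 1)) =
          (1 + q ^ (n + 1)) * ((-1) ^ (t + 1) * q ^ ((t + 1) * (n + 1)) *
          (∏ i ∈ Finset.range t, (1 + q ^ (i + 1))) *
          ∏ i ∈ Finset.Ico (t + 1) n, (1 - q ^ (i + 1))) + (D (t + 1) - D t) := by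
        intro t ht
        rw [Finset.mem_range] at ht
        simp only [hD]
        rw [Finset.prod_Ico_succ_top ht, Finset.prod_range_succ _ t,
          Finset.prod_eq_prod_Ico_succ_bot ht]
        ring
      have h0 : D 0 = -(q ^ (n + 1) * ∏ i ∈ Finset.range n, (1 - q ^ (i + 1))) := by
        simp [hD]
      have hn : D n = (-1) ^ (n + 1) * q ^ ((n + 1) ^ 2) *
          ∏ i ∈ Finset.range n, (1 + q ^ (i + 1)) := by
        simp [hD, sq]
      rw [Finset.sum_range_succ, Finset.sum_congr rfl hterm, Finset.sum_add_distrib, htel, h0, hn,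
        ← Finset.mul_sum, Finset.Ico_self, Finset.prod_empty, Finset.prod_range_succ _ n]
      ring
    rw [hstep, Finset.sum_range_succ _ n, Finset.prod_range_succ _ n, Finset.prod_range_succ _ n]
    linear_combination (1 + q ^ (n + 1)) * ih

theorem sum_neg_one_pow_mul_X_pow_sq_coeff {d n : ℕ} (h : d ≤ n) :
    coeff d ((1 : R⟦X⟧) + 2 * ∑ j ∈ Finset.range n, (-1) ^ (j + 1) * X ^ ((j + 1) ^ 2)) =
      coeff d (altTheta R) := by
  have hterm (j : ℕ) : coeff d ((-1 : R⟦X⟧) ^ (j + 1) * X ^ ((j + 1) ^ 2)) =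
      if d = (j + 1) ^ 2 then (-1) ^ (j + 1) else 0 := by
    have : (-1 : R⟦X⟧) ^ (j + 1) = C ((-1) ^ (j + 1)) := by simp
    rw [this, coeff_C_mul, coeff_X_pow]
    simp
  have h2 : (2 : R⟦X⟧) = C 2 := (map_ofNat C 2).symm
  rw [map_add, h2, coeff_C_mul, map_sum, Finset.sum_congr rfl fun j _ ↦ hterm j, coeff_one]
  rcases Nat.eq_zero_or_pos d with rfl | hd
  · rw [Finset.sum_eq_zero fun j _ ↦ if_neg (by positivity)]
    simp [altTheta]
  by_cases hs : IsSquare d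
  · obtain ⟨r, rfl⟩ := hs
    obtain ⟨k, rfl⟩ : ∃ k, r = k + 1 := Nat.exists_eq_succ_of_ne_zero (by rintro rfl; simp at hd)
    rw [Finset.sum_eq_single_of_mem k (Finset.mem_range.mpr (by nlinarith))]
    · have hpow : (-1 : R) ^ ((k + 1) * (k + 1)) = (-1) ^ (k + 1) := by
        rcases Nat.even_or_odd (k + 1) with hk | hk
        · rw [hk.neg_one_pow, (hk.mul_right _).neg_one_pow]
        · rw [hk.neg_one_pow, (hk.mul hk).neg_one_pow]
      rw [altTheta, coeff_mk, if_neg hd.ne', if_pos (sq (k + 1)).symm, if_neg hd.ne',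
        if_pos ⟨k + 1, rfl⟩, hpow, zero_add]
    · intro j _ hj
      rw [if_neg]
      intro h
      rw [← sq] at h
      have := Nat.pow_left_injective two_ne_zero h
      omega
  · rw [Finset.sum_eq_zero]
    · simp [altTheta, hs, hd.ne']
    · intro j _
      rw [if_neg]
      rintro rfl
      exact hs ⟨j + 1, sq _⟩

open Filter PowerSeries.WithPiTopology in
/-- The Gauss identity `∑ (-1) ^ j q ^ (j ^ 2) = ∏ (1 - q ^ i) / (1 + q ^ i)` for power series. -/
theorem altTheta_mul_eq [TopologicalSpace R] [IsTopologicalRing R] [T2Space R] {A B : R⟦X⟧}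
    (hA : HasProd (fun i ↦ 1 + (X : R⟦X⟧) ^ (i + 1)) A)
    (hB : HasProd (fun i ↦ 1 - (X : R⟦X⟧) ^ (i + 1)) B) :
    A * altTheta R = B := by
  have hS : Tendsto (fun n ↦ (1 : R⟦X⟧) +
      2 * ∑ j ∈ Finset.range n, (-1) ^ (j + 1) * X ^ ((j + 1) ^ 2)) atTop
      (nhds (altTheta R)) := by
    rw [tendsto_iff_coeff_tendsto]
    exact fun d ↦ tendsto_atTop_of_eventually_const (i₀ := d)
      fun n hn ↦ sum_neg_one_pow_mul_X_pow_sq_coeff hn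
  have hV : Tendsto (fun n ↦ 2 * ∑ t ∈ Finset.range n,
      (-1) ^ (t + 1) * (X : R⟦X⟧) ^ ((t + 1) * (n + 1)) *
        (∏ i ∈ Finset.range t, (1 + X ^ (i + 1))) *
        ∏ i ∈ Finset.Ico (t + 1) n, (1 - X ^ (i + 1))) atTop (nhds 0) := by
    rw [tendsto_iff_coeff_tendsto]
    refine fun d ↦ tendsto_atTop_of_eventually_const (i₀ := d) fun n hn ↦ ?_
    rw [map_zero]
    refine X_pow_dvd_iff.mp ?_ d (Nat.lt_succ_of_le hn)
    refine Dvd.dvd.mul_left (Finset.dvd_sum fun t _ ↦ ?_) _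
    refine Dvd.dvd.mul_right (Dvd.dvd.mul_right (Dvd.dvd.mul_left ?_ _) _) _
    exact pow_dvd_pow _ (Nat.le_mul_of_pos_left _ t.succ_pos)
  have hl := hA.tendsto_prod_nat.mul hS
  have hr := hB.tendsto_prod_nat.add hV
  rw [add_zero] at hr
  refine tendsto_nhds_unique hl (hr.congr fun n ↦ ?_)
  exact (prod_one_add_pow_mul_sum_neg_one_pow_mul_pow_sq X n).symm

variable (R) in
open PowerSeries.WithPiTopology in
theorem mk_pbar_mul_altTheta :
    (PowerSeries.mk fun n ↦ (pbar n : R)) * altTheta R = 1 := by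
  let _ : TopologicalSpace R := ⊥
  have _ : DiscreteTopology R := ⟨rfl⟩
  have hA : HasProd (fun i ↦ 1 + (X : R⟦X⟧) ^ (i + 1))
      (PowerSeries.mk fun n ↦ ((Nat.Partition.distincts n).card : R)) := by
    have hterm (i : ℕ) : ∑ j ∈ Finset.range 2, (X : R⟦X⟧) ^ ((i + 1) * j) = 1 + X ^ (i + 1) := by
      rw [Finset.sum_range_succ, Finset.sum_range_one, mul_zero, pow_zero, mul_one]
    simpa only [hterm, Nat.Partition.countRestricted_two] using
      Nat.Partition.hasProd_powerSeriesMk_card_countRestricted R two_pos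
  have hP : HasProd (fun i ↦ ∑' j : ℕ, (X : R⟦X⟧) ^ ((i + 1) * j))
      (PowerSeries.mk fun n ↦ (Fintype.card (Nat.Partition n) : R)) := by
    simpa [Nat.Partition.restricted] using
      Nat.Partition.hasProd_powerSeriesMk_card_restricted R (fun _ ↦ True)
  have hB := (multipliable_one_sub_X_pow R).hasProd
  have hPB := hP.mul hB
  have hinv (i : ℕ) : (∑' j : ℕ, (X : R⟦X⟧) ^ ((i + 1) * j)) * (1 - X ^ (i + 1)) = 1 := by
    simp_rw [pow_mul]
    exact tsum_pow_mul_one_sub_of_constantCoeff_eq_zero (by simp)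
  simp_rw [hinv] at hPB
  have h1 := hPB.unique hasProd_one
  have hpbar : (PowerSeries.mk fun n ↦ (pbar n : R)) =
      (PowerSeries.mk fun n ↦ ((Nat.Partition.distincts n).card : R)) *
      PowerSeries.mk fun n ↦ (Fintype.card (Nat.Partition n) : R) := by
    ext n
    simp [coeff_mul, pbar, Finset.Nat.sum_antidiagonal_eq_sum_range_succ_mk]
  rw [hpbar, mul_right_comm, altTheta_mul_eq hA hB, mul_comm, h1]

end Theta

section ModThree

theorem exists_coeff_ne_zero_of_coeff_mul_ne_zero {R : Type*} [Semiring R] {f g : R⟦X⟧} {n : ℕ}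
    (h : coeff n (f * g) ≠ 0) : ∃ i j, i + j = n ∧ coeff i f ≠ 0 ∧ coeff j g ≠ 0 := by
  rw [coeff_mul] at h
  obtain ⟨⟨i, j⟩, hij, hne⟩ := Finset.exists_ne_zero_of_sum_ne_zero h
  exact ⟨i, j, Finset.HasAntidiagonal.mem_antidiagonal.mp hij, left_ne_zero_of_mul hne,
    right_ne_zero_of_mul hne⟩

theorem pow_three_eq_expand (f : (ZMod 3)⟦X⟧) : f ^ 3 = expand 3 three_ne_zero f := by
  have h := MvPowerSeries.map_frobenius_expand (p := 3) three_ne_zero (f := f)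
  rw [ZMod.frobenius_zmod, MvPowerSeries.map_id] at h
  exact h.symm

theorem coeff_three_mul_pow_three (f : (ZMod 3)⟦X⟧) (n : ℕ) :
    coeff (3 * n) (f ^ 3) = coeff n f := by
  rw [pow_three_eq_expand, coeff_expand_mul]

theorem three_dvd_of_coeff_pow_three_ne_zero {f : (ZMod 3)⟦X⟧} {n : ℕ}
    (h : coeff n (f ^ 3) ≠ 0) : 3 ∣ n := by
  by_contra hn
  exact h (by rw [pow_three_eq_expand, coeff_expand_of_not_dvd _ _ _ hn])

theorem mod_three_eq_one_of_coeff_sub_ne_zero {n : ℕ}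
    (h : coeff n (altTheta (ZMod 3) - altTheta (ZMod 3) ^ 9) ≠ 0) : n % 3 = 1 := by
  have h9 : altTheta (ZMod 3) ^ 9 = (altTheta (ZMod 3) ^ 3) ^ 3 := by ring
  rw [h9, map_sub] at h
  by_cases h3 : 3 ∣ n
  · refine absurd ?_ h
    obtain ⟨m, rfl⟩ := h3
    rw [coeff_three_mul_pow_three, sub_eq_zero]
    by_cases hm : 3 ∣ m
    · obtain ⟨k, rfl⟩ := hm
      rw [coeff_three_mul_pow_three, ← mul_assoc]
      exact coeff_altTheta_nine_mul k
    · rw [not_imp_comm.mp three_dvd_of_coeff_pow_three_ne_zero hm]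
      by_contra hne
      obtain ⟨r, hr⟩ := isSquare_of_coeff_altTheta_ne_zero hne
      have h3 : 3 ∣ r := (Nat.prime_three.dvd_mul.mp (hr ▸ dvd_mul_right 3 m)).elim id id
      obtain ⟨s, rfl⟩ := h3
      exact hm ⟨s * s, by linarith⟩
  · rw [not_imp_comm.mp three_dvd_of_coeff_pow_three_ne_zero h3, sub_zero] at h
    obtain ⟨r, rfl⟩ := isSquare_of_coeff_altTheta_ne_zero h
    have : r % 3 = 0 ∨ r % 3 = 1 ∨ r % 3 = 2 := by omega
    rw [Nat.dvd_iff_mod_eq_zero, Nat.mul_mod] at h3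
    rw [Nat.mul_mod]
    rcases this with h | h | h <;> simp_all

theorem pbar_three_mul_eq_coeff (n : ℕ) :
    (pbar (3 * n) : ZMod 3) = coeff n (altTheta (ZMod 3) ^ 5) := by
  set φ := altTheta (ZMod 3)
  set P := PowerSeries.mk fun n ↦ (pbar n : ZMod 3)
  have hP : P * φ = 1 := mk_pbar_mul_altTheta (ZMod 3)
  set ψ := φ - φ ^ 9 with hψ
  have h3 : (3 : (ZMod 3)⟦X⟧) = 0 := by
    rw [← map_ofNat C 3, show (OfNat.ofNat 3 : ZMod 3) = 0 from rfl, map_zero]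
  have hdecomp : P = (φ ^ 5) ^ 3 + (-(φ ^ 3 * P) ^ 3 * ψ + P ^ 3 * ψ ^ 2) := by
    calc P = P * (P * φ) ^ 2 := by rw [hP, one_pow, mul_one]
      _ = P ^ 3 * (φ ^ 9 + ψ) ^ 2 := by rw [hψ]; ring
      _ = φ ^ 15 * (P * φ) ^ 3 + (-(φ ^ 3 * P) ^ 3 * ψ + P ^ 3 * ψ ^ 2) := by
        linear_combination φ ^ 9 * P ^ 3 * ψ * h3
      _ = _ := by rw [hP]; ring
  have hzero1 : coeff (3 * n) (-(φ ^ 3 * P) ^ 3 * ψ) = 0 := by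
    by_contra h
    obtain ⟨i, j, hij, hi, hj⟩ := exists_coeff_ne_zero_of_coeff_mul_ne_zero h
    have := mod_three_eq_one_of_coeff_sub_ne_zero hj
    rw [map_neg, neg_ne_zero] at hi
    have := three_dvd_of_coeff_pow_three_ne_zero hi
    omega
  have hzero2 : coeff (3 * n) (P ^ 3 * ψ ^ 2) = 0 := by
    by_contra h
    obtain ⟨i, j, hij, hi, hj⟩ := exists_coeff_ne_zero_of_coeff_mul_ne_zero h
    rw [sq] at hj
    obtain ⟨k, l, hkl, hk, hl⟩ := exists_coeff_ne_zero_of_coeff_mul_ne_zero hj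
    have := mod_three_eq_one_of_coeff_sub_ne_zero hk
    have := mod_three_eq_one_of_coeff_sub_ne_zero hl
    have := three_dvd_of_coeff_pow_three_ne_zero hi
    omega
  calc (pbar (3 * n) : ZMod 3) = coeff (3 * n) P := by simp [P]
    _ = coeff n (φ ^ 5) := by
      rw [hdecomp, map_add, map_add, hzero1, hzero2, coeff_three_mul_pow_three, add_zero, add_zero]

theorem exists_three_mul_sq_add_sq_add_sq_of_not_dvd_pbar {n : ℕ} (h : ¬ 3 ∣ pbar (3 * n)) :
    ∃ a b c : ℕ, 3 * a ^ 2 + b ^ 2 + c ^ 2 = n := by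
  rw [← ZMod.natCast_eq_zero_iff, pbar_three_mul_eq_coeff,
    show altTheta (ZMod 3) ^ 5 = altTheta (ZMod 3) ^ 3 * (altTheta (ZMod 3) * altTheta (ZMod 3))
      by ring] at h
  obtain ⟨i, j, hij, hi, hj⟩ := exists_coeff_ne_zero_of_coeff_mul_ne_zero h
  obtain ⟨k, rfl⟩ := three_dvd_of_coeff_pow_three_ne_zero hi
  rw [coeff_three_mul_pow_three] at hi
  obtain ⟨l, m, hlm, hl, hm⟩ := exists_coeff_ne_zero_of_coeff_mul_ne_zero hj
  obtain ⟨a, rfl⟩ := isSquare_of_coeff_altTheta_ne_zero hi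
  obtain ⟨b, rfl⟩ := isSquare_of_coeff_altTheta_ne_zero hl
  obtain ⟨c, rfl⟩ := isSquare_of_coeff_altTheta_ne_zero hm
  exact ⟨a, b, c, by rw [← hij, ← hlm]; ring⟩

theorem three_dvd_of_three_dvd_sq_add_sq {b c : ℕ} (h : 3 ∣ b ^ 2 + c ^ 2) : 3 ∣ b ∧ 3 ∣ c := by
  have hb : b % 3 = 0 ∨ b % 3 = 1 ∨ b % 3 = 2 := by omega
  have hc : c % 3 = 0 ∨ c % 3 = 1 ∨ c % 3 = 2 := by omega
  rw [Nat.dvd_iff_mod_eq_zero, Nat.add_mod, Nat.pow_mod, Nat.pow_mod c] at h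
  rcases hb with hb | hb | hb <;> rcases hc with hc | hc | hc <;> simp [hb, hc] at h
  omega

theorem three_mul_sq_add_sq_add_sq_ne (n α a b c : ℕ) :
    3 * a ^ 2 + b ^ 2 + c ^ 2 ≠ 9 ^ α * (9 * n + 6) := by
  induction α generalizing a b c with
  | zero =>
    intro h
    rw [pow_zero, one_mul] at h
    obtain ⟨⟨b, rfl⟩, c, rfl⟩ := three_dvd_of_three_dvd_sq_add_sq (b := b) (c := c) (by omega)
    rw [mul_pow, mul_pow] at h
    have h2 : a ^ 2 % 3 = 2 := by omega
    have ha : a % 3 = 0 ∨ a % 3 = 1 ∨ a % 3 = 2 := by omega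
    rw [Nat.pow_mod] at h2
    rcases ha with ha | ha | ha <;> simp [ha] at h2
  | succ α ih =>
    intro h
    rw [pow_succ 9, mul_right_comm] at h
    obtain ⟨⟨b, rfl⟩, c, rfl⟩ := three_dvd_of_three_dvd_sq_add_sq (b := b) (c := c) (by omega)
    rw [mul_pow, mul_pow] at h
    have ha : 3 ∣ a := Nat.prime_three.dvd_of_dvd_pow (n := 2) (by omega)
    obtain ⟨a, rfl⟩ := ha
    rw [mul_pow] at h
    exact ih a b c (by omega)

end ModThree

end Overpartition

theorem pbar_cong_27_18 (n α : ℕ) :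
    pbar (3 ^ (2 * α) * (27 * n + 18)) ≡ 0 [MOD 3] := by
  rw [Nat.modEq_zero_iff_dvd,
    show 3 ^ (2 * α) * (27 * n + 18) = 3 * (9 ^ α * (9 * n + 6)) by rw [pow_mul]; norm_num; ring]
  by_contra h
  obtain ⟨a, b, c, habc⟩ :=
    Overpartition.exists_three_mul_sq_add_sq_add_sq_of_not_dvd_pbar h
  exact Overpartition.three_mul_sq_add_sq_add_sq_ne n α a b c habc
end
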